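/- arXiv:1911.08574 — 5 statements merged into one kernel-verified Lean document; each statement's English description precedes it below -/
import Mathlib

section
/- The variety Q = Mod{xyx ≈ xyx², x²y² ≈ y²x², xyx ≈ x²yx} is hereditarily finitely based: for every set Σ of identities there exists a finite set Σ′ of identities such that a monoid satisfies all identities of {xyx ≈ xyx², x²y² ≈ y²x², xyx ≈ x²yx} ∪ Σ if and only if it satisfies all identities of Σ′. -/
open FreeMonoid

/-- Words over the countably infinite alphabet `ℕ`. -/
abbrev Word : Type := FreeMonoid ℕ

/-- The word corresponding to a list of letters. -/
def wd (l : List ℕ) : Word := FreeMonoid.ofList l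

/-- A monoid `M` satisfies the identity `e.1 ≈ e.2`. -/
def MSat (M : Type*) [Monoid M] (e : Word × Word) : Prop :=
  ∀ φ : Word →* M, φ e.1 = φ e.2

/-- A monoid `M` satisfies every identity of `S`. -/
def SatAll (M : Type*) [Monoid M] (S : Set (Word × Word)) : Prop :=
  ∀ e ∈ S, MSat M e

/-- The varieties `Mod S` and `Mod T` coincide (they have exactly the same members). -/
def VarEq.{u} (S T : Set (Word × Word)) : Prop :=
  ∀ (M : Type u) [Monoid M], SatAll M S ↔ SatAll M T

/-- The variety `Mod S` is finitely based. -/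
def FinitelyBased.{u} (S : Set (Word × Word)) : Prop :=
  ∃ T : Finset (Word × Word), VarEq.{u} S (↑T)

/-- `G` is a subgroup (a subsemigroup which is a group) of the monoid `M`. -/
def IsSubgroupIn (M : Type*) [Monoid M] (G : Set M) : Prop :=
  (∀ a ∈ G, ∀ b ∈ G, a * b ∈ G) ∧
    ∃ e ∈ G, (∀ g ∈ G, e * g = g ∧ g * e = g) ∧ ∀ g ∈ G, ∃ h ∈ G, g * h = e ∧ h * g = e

/-- A monoid is aperiodic if all its subgroups have exactly one element. -/
def AperiodicMonoid (M : Type*) [Monoid M] : Prop :=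
  ∀ G : Set M, IsSubgroupIn M G → ∀ a ∈ G, ∀ b ∈ G, a = b

/-- The idempotents of `M` commute. -/
def CommIdem (M : Type*) [Monoid M] : Prop :=
  ∀ e f : M, e * e = e → f * f = f → e * f = f * e

/-- `w` is a factor (contiguous subword) of some word of `W`. -/
def IsFactorIn (W : Set (List ℕ)) (w : List ℕ) : Prop := ∃ s ∈ W, w <:+: s

theorem IsFactorIn.left {W : Set (List ℕ)} {u v : List ℕ} (h : IsFactorIn W (u ++ v)) :
    IsFactorIn W u := by
  obtain ⟨s, hs, hf⟩ := h
  exact ⟨s, hs, (List.prefix_append u v).isInfix.trans hf⟩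

theorem IsFactorIn.right {W : Set (List ℕ)} {u v : List ℕ} (h : IsFactorIn W (u ++ v)) :
    IsFactorIn W v := by
  obtain ⟨s, hs, hf⟩ := h
  exact ⟨s, hs, (List.suffix_append u v).isInfix.trans hf⟩

/-- The Rees congruence on the free monoid identifying all non-factors of words of `W`. -/
def reesCon (W : Set (List ℕ)) : Con Word where
  r u v := u = v ∨ (¬ IsFactorIn W (toList u) ∧ ¬ IsFactorIn W (toList v))
  iseqv := ⟨fun _ => Or.inl rfl, fun h => by tauto, fun h₁ h₂ => by
    rcases h₁ with rfl | h₁ <;> rcases h₂ with rfl | h₂ <;> tauto⟩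
  mul' := by
    rintro w x y z (rfl | ⟨hw, hx⟩) (rfl | ⟨hy, hz⟩)
    · exact Or.inl rfl
    · refine Or.inr ⟨fun h => hy ?_, fun h => hz ?_⟩
      · rw [toList_mul] at h; exact h.right
      · rw [toList_mul] at h; exact h.right
    · refine Or.inr ⟨fun h => hw ?_, fun h => hx ?_⟩
      · rw [toList_mul] at h; exact h.left
      · rw [toList_mul] at h; exact h.left
    · refine Or.inr ⟨fun h => hw ?_, fun h => hx ?_⟩
      · rw [toList_mul] at h; exact h.left
      · rw [toList_mul] at h; exact h.left

/-- The Rees quotient `S(W)` of the free monoid over the ideal of all words that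
are not factors of any word in `W`. -/
abbrev SMon (W : Set (List ℕ)) : Type := (reesCon W).Quotient

/-- The equational theory of the monoid `N`; `Mod (Th N)` is the variety generated by `N`. -/
def Th (N : Type*) [Monoid N] : Set (Word × Word) := {e | MSat N e}

/-- The reverse of a word. -/
def revW (w : Word) : Word := ofList (toList w).reverse

/-- The set of identities defining the dual variety. -/
def dualSet (S : Set (Word × Word)) : Set (Word × Word) :=
  (fun e : Word × Word => (revW e.1, revW e.2)) '' S

/-- letters: x = 0, y = 1, z = 2, t = 3. -/
def Oset : Set (Word × Word) :=
  {(wd [0,0,1,1], wd [1,1,0,0]), (wd [0,2,0,1,0,3,1], wd [0,2,1,0,3,1])}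

def Kset : Set (Word × Word) :=
  {(wd [0,1,0], wd [0,1,0,0]), (wd [0,0,1,1], wd [1,1,0,0]), (wd [0,0,1], wd [0,0,1,0])}

def Qset : Set (Word × Word) :=
  {(wd [0,1,0], wd [0,1,0,0]), (wd [0,0,1,1], wd [1,1,0,0]), (wd [0,1,0], wd [0,0,1,0])}

def Eset : Set (Word × Word) :=
  {(wd [0,0,1,1], wd [1,1,0,0]), (wd [0,0], wd [0,0,0]), (wd [1,0,0], wd [0,1,0])}

def F0set : Set (Word × Word) :=
  {(wd [0,1,0], wd [0,1,0,0]), (wd [0,0,1,1], wd [1,1,0,0]),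
   (wd [0,1,2,0,1], wd [1,0,2,0,1]), (wd [0,0,1], wd [0,0,1,0])}

/-- The identity `x z_{π(1)}⋯z_{π(n)} x (t₁z₁)⋯(tₙzₙ) ≈ x² z_{π(1)}⋯z_{π(n)} (t₁z₁)⋯(tₙzₙ)`,
with letters `x = 0`, `zᵢ = 2i+1`, `tᵢ = 2i+2`. -/
def Jscheme (n : ℕ) (π : Equiv.Perm (Fin n)) : Word × Word :=
  (of 0 * ((List.finRange n).map fun i => of (2 * (π i : ℕ) + 1)).prod * of 0 *
      ((List.finRange n).map fun i => of (2 * (i : ℕ) + 2) * of (2 * (i : ℕ) + 1)).prod,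
   of 0 * of 0 * ((List.finRange n).map fun i => of (2 * (π i : ℕ) + 1)).prod *
      ((List.finRange n).map fun i => of (2 * (i : ℕ) + 2) * of (2 * (i : ℕ) + 1)).prod)

/-- The defining identities of the variety `J`. -/
def Jset : Set (Word × Word) :=
  {(wd [0,1,0], wd [0,1,0,0]), (wd [0,0,1,1], wd [1,1,0,0]),
   (wd [0,1,2,0,1], wd [1,0,2,0,1]), (wd [0,1,0,2,3,0], wd [0,1,0,2,0,3,0])} ∪
  {e | ∃ n : ℕ, 1 ≤ n ∧ ∃ π : Equiv.Perm (Fin n), e = Jscheme n π}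

/-- The set of letters occurring in a word. -/
def conL (w : List ℕ) : Set ℕ := {a | a ∈ w}

/-- The set of simple letters of a word. -/
def simpleSet (w : List ℕ) : Set ℕ := {a | w.count a = 1}

/-- The set of multiple letters of a word. -/
def mulSet (w : List ℕ) : Set ℕ := {a | 2 ≤ w.count a}

/-- The position of the `i`-th occurrence (`i ≥ 1`) of the letter `a` in `w`. -/
def nthOccIdx (w : List ℕ) (a : ℕ) (i : ℕ) : ℕ :=
  ((List.range w.length).filter fun j => w.getD j (a + 1) == a).getD (i - 1) w.length

/-- `h_i(w,a)`: the right-most divider (simple letter) of `w` preceding the `i`-th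
occurrence of `a` in `w`; `none` encodes the empty divider `t₀`. -/
def hdiv (w : List ℕ) (a : ℕ) (i : ℕ) : Option ℕ :=
  ((w.take (nthOccIdx w a i)).filter fun b => w.count b == 1).getLast?

/-- `t(w,a)`: the right-most divider of `w` preceding the last occurrence of `a` in `w`. -/
def tdiv (w : List ℕ) (a : ℕ) : Option ℕ := hdiv w a (w.count a)

/-- The word `b₀ t₁ b₁ t₂ b₂ ⋯ tₘ bₘ` built from blocks and dividers. -/
def assemble (b0 : List ℕ) (ps : List (ℕ × List ℕ)) : List ℕ :=
  b0 ++ (ps.map fun p => p.1 :: p.2).flatten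

/-- `t₀ b₀ t₁ b₁ ⋯ tₘ bₘ` is the decomposition of `w`: the `tᵢ` are the dividers
(simple letters) of `w` and the blocks `bᵢ` consist of multiple letters. -/
def IsDecomp (w b0 : List ℕ) (ps : List (ℕ × List ℕ)) : Prop :=
  w = assemble b0 ps ∧ (∀ p ∈ ps, w.count p.1 = 1) ∧
    (∀ a ∈ b0, 2 ≤ w.count a) ∧ ∀ p ∈ ps, ∀ a ∈ p.2, 2 ≤ w.count a

/-- The identity `u ≈ v` is well-balanced: `u` and `v` have the same dividers in the
same order and corresponding blocks have the same number of occurrences of each letter. -/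
def WellBalanced (u v : List ℕ) : Prop :=
  ∃ b0 ps c0 qs, IsDecomp u b0 ps ∧ IsDecomp v c0 qs ∧
    ps.map Prod.fst = qs.map Prod.fst ∧
    List.Forall₂ (fun b c : List ℕ => ∀ a, b.count a = c.count a)
      (b0 :: ps.map Prod.snd) (c0 :: qs.map Prod.snd)

/-- `∏_{i=a}^{b} tᵢ eᵢ` where `tᵢ = i+1`, `eᵢ = x = 0` for odd `i` and `eᵢ = y = 1`
for even `i`. -/
def prodTE (a b : ℕ) : Word :=
  ((List.range' a (b + 1 - a)).map fun i =>
    of (i + 1) * of (if i % 2 = 1 then 0 else 1)).prod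

def alphaId (n : ℕ) : Word × Word :=
  (wd [0,1] * prodTE 1 (n+1), wd [1,0] * prodTE 1 (n+1))

def betaId (n : ℕ) : Word × Word :=
  (wd [1,0,0] * prodTE 2 (n+1), wd [0,1,0] * prodTE 1 n)

def gammaId (n : ℕ) : Word × Word :=
  (wd [0,0,1] * prodTE 1 (n+1), wd [0,1,0] * prodTE 1 (n+1))

def gammaId' (n : ℕ) : Word × Word :=
  (wd [0,0,1] * prodTE 2 (n+1), wd [0,1,0] * prodTE 2 (n+1))

/-- The family `Φ` of identities from Lemma 3.5 (letters `x = 0`, `y = 1`, `t = 2`). -/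
def PhiSet : Set (Word × Word) :=
  {(wd [0,1,2,0,1], wd [1,0,2,0,1]), (wd [1,0,0,2,0,1], wd [0,1,0,2,0,1]),
   (wd [0,0,1,2,0,1], wd [0,1,0,2,0,1])} ∪
  {e | ∃ n : ℕ, 1 ≤ n ∧ (e = alphaId n ∨ e = betaId n ∨ e = gammaId n ∨ e = gammaId' n)}
universe uM


namespace QHFB

/-- Value of the word `l` under the assignment `f`. -/
def ev {M : Type*} [Monoid M] (f : ℕ → M) (l : List ℕ) : M := (l.map f).prod

section basic
variable {M : Type*} [Monoid M]

@[simp] theorem ev_nil (f : ℕ → M) : ev f [] = 1 := by simp [ev]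
@[simp] theorem ev_cons (f : ℕ → M) (a : ℕ) (l : List ℕ) : ev f (a :: l) = f a * ev f l := by
  simp [ev]
@[simp] theorem ev_append (f : ℕ → M) (l k : List ℕ) : ev f (l ++ k) = ev f l * ev f k := by
  simp [ev]

theorem ev_congr {f g : ℕ → M} {l : List ℕ} (h : ∀ z ∈ l, f z = g z) : ev f l = ev g l := by
  unfold ev
  rw [List.map_congr_left h]

theorem ev_one {f : ℕ → M} {l : List ℕ} (h : ∀ z ∈ l, f z = 1) : ev f l = 1 := by
  induction l with
  | nil => simp
  | cons a l ih =>
    rw [ev_cons, h a (by simp), ih (fun z hz => h z (by simp [hz])), one_mul]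

theorem ev_single {f : ℕ → M} {x : ℕ} {l : List ℕ} (hX : f x * f x = f x)
    (h : ∀ z ∈ l, z ≠ x → f z = 1) : ev f l = if x ∈ l then f x else 1 := by
  induction l with
  | nil => simp
  | cons a l ih =>
    rw [ev_cons, ih (fun z hz => h z (by simp [hz]))]
    by_cases ha : a = x
    · subst ha
      by_cases hl : a ∈ l <;> simp [hl, hX]
    · rw [h a (by simp) ha]
      have : x ≠ a := fun e => ha e.symm
      simp [this]

theorem ev_pow (x : ℕ) (a : M) (l : List ℕ) :
    ev (fun z => if z = x then a else 1) l = a ^ (l.count x) := by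
  induction l with
  | nil => simp
  | cons b l ih =>
    rw [ev_cons, ih]
    by_cases hb : b = x
    · subst hb; simp [pow_succ']
    · simp [hb]

theorem msat_iff (e : Word × Word) :
    MSat M e ↔ ∀ f : ℕ → M, ev f (toList e.1) = ev f (toList e.2) := by
  constructor
  · intro h f
    have := h (FreeMonoid.lift f)
    simpa [FreeMonoid.lift_apply, ev] using this
  · intro h φ
    have := h (fun n => φ (of n))
    have key : ∀ w : Word, φ w = ev (fun n => φ (of n)) (toList w) := by
      intro w
      induction w using FreeMonoid.inductionOn' with
      | one => simp
      | of_mul x w ih => simp [ih]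
    rw [key, key, this]

end basic

/-- Semantic form of the identities of `Q`. -/
structure InQ (M : Type*) [Monoid M] : Prop where
  r : ∀ x y : M, x * y * x = x * y * x * x
  c : ∀ x y : M, x * x * y * y = y * y * x * x
  l : ∀ x y : M, x * y * x = x * x * y * x

theorem inQ_iff {M : Type*} [Monoid M] : SatAll M Qset ↔ InQ M := by
  simp only [SatAll, Qset, Set.mem_insert_iff, Set.mem_singleton_iff, forall_eq_or_imp, forall_eq,
    msat_iff, wd, toList_ofList, ev_cons, ev_nil, mul_one]
  constructor
  · rintro ⟨h1, h2, h3⟩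
    refine ⟨fun x y => ?_, fun x y => ?_, fun x y => ?_⟩
    · simpa [mul_assoc] using h1 (fun n => if n = 0 then x else y)
    · simpa [mul_assoc] using h2 (fun n => if n = 0 then x else y)
    · simpa [mul_assoc] using h3 (fun n => if n = 0 then x else y)
  · intro h
    refine ⟨fun f => ?_, fun f => ?_, fun f => ?_⟩
    · simpa [mul_assoc] using h.r (f 0) (f 1)
    · simpa [mul_assoc] using h.c (f 0) (f 1)
    · simpa [mul_assoc] using h.l (f 0) (f 1)

section Q
variable {M : Type*} [Monoid M]

theorem InQ.cube (hQ : InQ M) (a : M) : a * a = a * a * a := by simpa using hQ.r a 1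

theorem InQ.idem (hQ : InQ M) (a : M) : (a * a) * (a * a) = a * a := by
  rw [← mul_assoc, ← hQ.cube a, ← hQ.cube a]

theorem InQ.comm (hQ : InQ M) (a b : M) : (a * a) * (b * b) = (b * b) * (a * a) := by
  simpa [mul_assoc] using hQ.c a b

theorem InQ.pow (hQ : InQ M) (a : M) (k : ℕ) : a ^ (k + 2) = a * a := by
  induction k with
  | zero => simp [pow_two]
  | succ k ih => rw [show k + 1 + 2 = (k + 2) + 1 by ring, pow_succ, ih, ← hQ.cube]

theorem InQ.pow' (hQ : InQ M) (a : M) {k : ℕ} (hk : 2 ≤ k) : a ^ k = a * a := by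
  obtain ⟨j, rfl⟩ := Nat.exists_eq_add_of_le' hk
  exact hQ.pow a j

theorem sq_after (hQ : InQ M) (f : ℕ → M) (x : ℕ) (w : List ℕ) : ∀ a : M,
    f x * a * ev f w = f x * a * ev (Function.update f x (f x * f x)) w := by
  induction w with
  | nil => simp
  | cons y w ih =>
    intro a
    by_cases hy : y = x
    · subst hy
      have h1 := ih (a * f y * f y)
      simp only [ev_cons, Function.update_self]
      calc f y * a * (f y * ev f w) = (f y * a * f y) * ev f w := by simp only [mul_assoc]
        _ = f y * (a * f y * f y) * ev f w := by rw [hQ.r]; simp only [mul_assoc]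
        _ = _ := by rw [h1]; simp only [mul_assoc]
    · have h1 := ih (a * f y)
      simp only [ev_cons, Function.update_of_ne hy]
      simpa only [mul_assoc] using h1

theorem sq_one (hQ : InQ M) (f : ℕ → M) (x : ℕ) (w : List ℕ) (hw : 2 ≤ w.count x) :
    ev f w = ev (Function.update f x (f x * f x)) w := by
  have hx : x ∈ w := List.count_pos_iff.1 (by omega)
  obtain ⟨c, d, rfl, hc⟩ := List.eq_append_cons_of_mem hx
  have hc0 : c.count x = 0 := List.count_eq_zero.2 hc
  have hd : x ∈ d := by
    apply List.count_pos_iff.1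
    simp [hc0] at hw
    exact List.count_pos_iff.2 hw
  obtain ⟨d1, d2, rfl⟩ := List.append_of_mem hd
  have e1 : ev f c = ev (Function.update f x (f x * f x)) c := by
    apply ev_congr
    intro z hz
    rw [Function.update_of_ne]
    rintro rfl
    exact hc hz
  have e2 := sq_after hQ f x (d1 ++ x :: d2) 1
  rw [ev_append, ev_append, ev_cons, ev_cons, e1]
  simp only [mul_one] at e2
  rw [e2]
  simp only [ev_append, ev_cons, Function.update_self]
  congr 1
  generalize ev (Function.update f x (f x * f x)) d1 = D
  generalize ev (Function.update f x (f x * f x)) d2 = E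
  calc f x * (D * (f x * f x * E)) = (f x * D * f x * f x) * E := by simp only [mul_assoc]
    _ = (f x * D * f x) * E := by rw [← hQ.r]
    _ = f x * (f x * D * f x) * E := by
        rw [hQ.l]; simp only [mul_assoc]
        rw [show f x * (f x * (f x * (D * (f x * E)))) = (f x * f x * f x) * (D * (f x * E)) by
          simp only [mul_assoc], ← hQ.cube]
        simp only [mul_assoc]
    _ = f x * (f x * D * f x * f x) * E := by rw [← hQ.r]
    _ = _ := by simp only [mul_assoc]

theorem sq_finset (hQ : InQ M) (f : ℕ → M) (w : List ℕ) (s : Finset ℕ) (hs : ∀ x ∈ s, 2 ≤ w.count x) :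
    ev f w = ev (fun z => if z ∈ s then f z * f z else f z) w := by
  induction s using Finset.induction_on with
  | empty => simp
  | insert x s hx ih =>
    rw [ih (fun y hy => hs y (by simp [hy])), sq_one hQ _ x w (hs x (by simp))]
    congr 1
    funext z
    by_cases hz : z = x
    · subst hz; simp [hx]
    · simp [hz]

theorem sq_all (hQ : InQ M) (f : ℕ → M) (w : List ℕ) (S : ℕ → Bool) (hS : ∀ x ∈ w, S x = false → 2 ≤ w.count x) :
    ev f w = ev (fun z => if S z then f z else f z * f z) w := by
  rw [sq_finset hQ f w (w.toFinset.filter (fun x => S x = false))]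
  · apply ev_congr
    intro z hz
    by_cases h : S z <;> simp [h, hz]
  · intro x hx
    simp at hx
    exact hS x hx.1 hx.2

theorem comm_case (hcomm : ∀ a b : M, a * b = b * a) (u v : List ℕ)
    (h : ∀ (x : ℕ) (a : M), a ^ (u.count x) = a ^ (v.count x)) (f : ℕ → M) : ev f u = ev f v := by
  let _ : CommMonoid M := { ‹Monoid M› with mul_comm := hcomm }
  have key : ∀ w : List ℕ, w.toFinset ⊆ u.toFinset ∪ v.toFinset →
      ev f w = ∏ x ∈ u.toFinset ∪ v.toFinset, f x ^ w.count x := by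
    intro w hw
    unfold ev
    rw [Finset.prod_list_map_count]
    apply Finset.prod_subset hw
    intro x _ hx
    rw [List.count_eq_zero.2 (by simpa using hx), pow_zero]
  rw [key u Finset.subset_union_left, key v Finset.subset_union_right]
  exact Finset.prod_congr rfl (fun x _ => h x (f x))

end Q

/-! Merging -/

inductive Merge (S : ℕ → Bool) : List ℕ → List ℕ → List ℕ → Prop
  | nil : Merge S [] [] []
  | left {x u v w} : S x = false → Merge S u v w → Merge S (x :: u) v (x :: w)
  | right {x u v w} : S x = false → Merge S u v w → Merge S u (x :: v) (x :: w)
  | both {t u v w} : S t = true → Merge S u v w → Merge S (t :: u) (t :: v) (t :: w)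

theorem Merge.symm {S : ℕ → Bool} {u v w : List ℕ} (h : Merge S u v w) : Merge S v u w := by
  induction h with
  | nil => exact .nil
  | left h _ ih => exact .right h ih
  | right h _ ih => exact .left h ih
  | both h _ ih => exact .both h ih

theorem exists_merge (S : ℕ → Bool) (u : List ℕ) :
    ∀ v : List ℕ, u.filter S = v.filter S → ∃ w, Merge S u v w := by
  induction u with
  | nil =>
    intro v
    induction v with
    | nil => exact fun _ => ⟨_, .nil⟩
    | cons y v ih =>
      intro h
      by_cases hy : S y
      · simp [hy] at h
      · have hy' : S y = false := by simpa using hy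
        obtain ⟨w, hw⟩ := ih (by simpa [hy'] using h)
        exact ⟨_, .right hy' hw⟩
  | cons x u ihu =>
    intro v h
    by_cases hx : S x
    · induction v with
      | nil => simp [hx] at h
      | cons y v ih =>
        by_cases hy : S y
        · rw [List.filter_cons_of_pos hx, List.filter_cons_of_pos hy] at h
          injection h with h1 h2
          subst h1
          obtain ⟨w, hw⟩ := ihu v h2
          exact ⟨_, .both hx hw⟩
        · have hy' : S y = false := by simpa using hy
          obtain ⟨w, hw⟩ := ih (by rw [h]; simp [hy'])
          exact ⟨_, .right hy' hw⟩
    · have hx' : S x = false := by simpa using hx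
      obtain ⟨w, hw⟩ := ihu v (by rw [← h]; simp [hx'])
      exact ⟨_, .left hx' hw⟩

def InLast (S : ℕ → Bool) (x : ℕ) (u : List ℕ) : Prop :=
  ∃ c d, u = c ++ x :: d ∧ ∀ z ∈ d, S z = false

def InFirst (S : ℕ → Bool) (x : ℕ) (u : List ℕ) : Prop :=
  ∃ c d, u = c ++ x :: d ∧ ∀ z ∈ c, S z = false

theorem inLast_concat {S : ℕ → Bool} {x y : ℕ} {u : List ℕ} (h : InLast S x (u ++ [y])) :
    (x = y) ∨ (S y = false ∧ InLast S x u) := by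
  obtain ⟨c, d, he, hd⟩ := h
  rcases List.eq_nil_or_concat d with rfl | ⟨d', z, rfl⟩
  · left
    have := List.append_inj' he rfl
    simpa using this.2.symm
  · right
    have he' : u ++ [y] = (c ++ x :: d') ++ [z] := by simpa using he
    have := List.append_inj' he' rfl
    have hyz : y = z := by simpa using this.2
    subst hyz
    exact ⟨hd y (by simp), c, d', this.1, fun z hz => hd z (by simp [hz])⟩

section progress
variable {M : Type*} [Monoid M] {S : ℕ → Bool} {g : ℕ → M}

theorem absorb_first
    (hidem : ∀ x, S x = false → g x * g x = g x)
    (hcomm : ∀ x y, S x = false → S y = false → g x * g y = g y * g x)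
    {x : ℕ} {u : List ℕ} (hx : S x = false) (h : InFirst S x u) :
    g x * ev g u = ev g u := by
  obtain ⟨c, d, rfl, hc⟩ := h
  induction c with
  | nil => simp [← mul_assoc, hidem x hx]
  | cons y c ih =>
    have := ih (fun z hz => hc z (by simp [hz]))
    rw [List.cons_append, ev_cons, ← mul_assoc, hcomm x y hx (hc y (by simp)), mul_assoc, this]

theorem progress
    (hidem : ∀ x, S x = false → g x * g x = g x)
    (hcomm : ∀ x y, S x = false → S y = false → g x * g y = g y * g x)
    {U V : List ℕ}
    (hC : ∀ u1 u2 v1 v2 x, S x = false → U = u1 ++ u2 → V = v1 ++ x :: v2 →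
      u1.filter S = v1.filter S → InLast S x u1 ∨ InFirst S x u2 ∨
        ∀ w1, u1 ⊆ w1 → ev g w1 * ev g u2 = ev g w1 * g x * ev g u2)
    {u2 v2 w2 : List ℕ} (hm : Merge S u2 v2 w2) : ∀ u1 v1 w1, U = u1 ++ u2 → V = v1 ++ v2 →
      u1.filter S = v1.filter S → u1 ⊆ w1 →
      (∀ x, S x = false → InLast S x u1 → ev g w1 * g x = ev g w1) →
      ev g w1 * ev g u2 = ev g w1 * ev g w2 := by
  induction hm with
  | nil => intros; rfl
  | @left x u v w hx _ ih =>
    intro u1 v1 w1 hU hV hf hs hK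
    have := ih (u1 ++ [x]) v1 (w1 ++ [x]) (by simpa using hU) hV (by simpa [hx] using hf)
      (by
        intro z hz
        rcases List.mem_append.1 hz with hz | hz
        · exact List.mem_append_left _ (hs hz)
        · exact List.mem_append_right _ hz)
      (by
        intro z hz hl
        rcases inLast_concat hl with rfl | ⟨_, hl⟩
        · simp [mul_assoc, hidem z hz]
        · simp only [ev_append, ev_cons, ev_nil, mul_one]
          rw [mul_assoc, hcomm x z hx hz, ← mul_assoc, hK z hz hl])
    simpa [mul_assoc] using this
  | @right x u v w hx _ ih =>
    intro u1 v1 w1 hU hV hf hs hK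
    have h1 : ev g w1 * ev g u = ev g w1 * g x * ev g u := by
      rcases hC u1 u v1 v x hx hU hV hf with h | h | h
      · rw [hK x hx h]
      · rw [mul_assoc, absorb_first hidem hcomm hx h]
      · exact h w1 hs
    have := ih u1 (v1 ++ [x]) (w1 ++ [x]) hU (by simpa using hV) (by simpa [hx] using hf)
      (by
        intro z hz
        exact List.mem_append_left _ (hs hz))
      (by
        intro z hz hl
        simp only [ev_append, ev_cons, ev_nil, mul_one]
        rw [mul_assoc, hcomm x z hx hz, ← mul_assoc, hK z hz hl])
    rw [h1]
    simpa [mul_assoc] using this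
  | @both t u v w ht _ ih =>
    intro u1 v1 w1 hU hV hf hs hK
    have := ih (u1 ++ [t]) (v1 ++ [t]) (w1 ++ [t]) (by simpa using hU) (by simpa using hV)
      (by simpa [ht] using hf)
      (by
        intro z hz
        rcases List.mem_append.1 hz with hz | hz
        · exact List.mem_append_left _ (hs hz)
        · exact List.mem_append_right _ hz)
      (by
        intro z hz hl
        rcases inLast_concat hl with rfl | ⟨h, _⟩
        · simp [ht] at hz
        · simp [ht] at h)
    simpa [mul_assoc] using this

end progress

theorem lastBlock (S : ℕ → Bool) (u : List ℕ) : (∀ z ∈ u, S z = false) ∨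
    ∃ a t b, u = a ++ t :: b ∧ S t = true ∧ ∀ z ∈ b, S z = false := by
  induction u with
  | nil => left; simp
  | cons x u ih =>
    rcases ih with h | ⟨a, t, b, rfl, ht, hb⟩
    · by_cases hx : S x
      · exact Or.inr ⟨[], x, u, rfl, hx, h⟩
      · left
        intro z hz
        rcases List.mem_cons.1 hz with rfl | hz
        · simpa using hx
        · exact h z hz
    · exact Or.inr ⟨x :: a, t, b, rfl, ht, hb⟩

theorem firstBlock (S : ℕ → Bool) (u : List ℕ) : (∀ z ∈ u, S z = false) ∨
    ∃ a t b, u = a ++ t :: b ∧ S t = true ∧ ∀ z ∈ a, S z = false := by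
  induction u with
  | nil => left; simp
  | cons x u ih =>
    by_cases hx : S x
    · exact Or.inr ⟨[], x, u, rfl, hx, by simp⟩
    · have hx' : S x = false := by simpa using hx
      rcases ih with h | ⟨a, t, b, rfl, ht, hb⟩
      · left
        intro z hz
        rcases List.mem_cons.1 hz with rfl | hz
        · exact hx'
        · exact h z hz
      · refine Or.inr ⟨x :: a, t, b, rfl, ht, ?_⟩
        intro z hz
        rcases List.mem_cons.1 hz with rfl | hz
        · exact hx'
        · exact hb z hz

theorem filter_none {S : ℕ → Bool} {u : List ℕ} (h : ∀ z ∈ u, S z = false) : u.filter S = [] := by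
  rw [List.filter_eq_nil_iff]
  intro z hz
  simp [h z hz]

theorem last_match {S : ℕ → Bool} {a b v : List ℕ} {t : ℕ} (ht : S t = true)
    (hb : ∀ z ∈ b, S z = false) (h : (a ++ t :: b).filter S = v.filter S) :
    ∃ a' b', v = a' ++ t :: b' ∧ ∀ z ∈ b', S z = false := by
  rcases lastBlock S v with hv | ⟨a', t', b', rfl, ht', hb'⟩
  · rw [filter_none hv] at h
    simp [ht] at h
  · rw [List.filter_append, List.filter_append, List.filter_cons_of_pos ht,
      List.filter_cons_of_pos ht', filter_none hb, filter_none hb'] at h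
    have := (List.append_inj' h rfl).2
    have e : t = t' := by simpa using this
    subst e
    exact ⟨a', b', rfl, hb'⟩

theorem first_match {S : ℕ → Bool} {a b v : List ℕ} {t : ℕ} (ht : S t = true)
    (ha : ∀ z ∈ a, S z = false) (h : (a ++ t :: b).filter S = v.filter S) :
    ∃ a' b', v = a' ++ t :: b' ∧ ∀ z ∈ a', S z = false := by
  rcases firstBlock S v with hv | ⟨a', t', b', rfl, ht', ha'⟩
  · rw [filter_none hv] at h
    simp [ht] at h
  · rw [List.filter_append, List.filter_append, List.filter_cons_of_pos ht,
      List.filter_cons_of_pos ht', filter_none ha, filter_none ha'] at h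
    have e : t = t' := by
      simp only [List.nil_append] at h
      injection h
    subst e
    exact ⟨a', b', rfl, ha'⟩

theorem not_mem_of_count {a b : List ℕ} {t : ℕ} (h : (a ++ t :: b).count t = 1) :
    t ∉ a ∧ t ∉ b := by
  rw [List.count_append, List.count_cons_self] at h
  exact ⟨List.count_eq_zero.1 (by omega), List.count_eq_zero.1 (by omega)⟩

section sigma

def asg {M : Type*} (y T s : M) : ℕ → M := fun n => if n = 0 then y else if n = 1 then T else s

def sig (p q : List ℕ) : Word × Word := (wd (p ++ q), wd (p ++ [0, 0] ++ q))

def LOK {M : Type*} [Monoid M] (p : List ℕ) (y W : M) : Prop :=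
  ∃ L T, ∀ s, W = L * ev (asg y T s) p

def ROK {M : Type*} [Monoid M] (q : List ℕ) (y W : M) : Prop :=
  ∃ R s, ∀ T, W = ev (asg y T s) q * R

def PL : List (List ℕ) := [[], [1], [0, 0, 1]]
def QL : List (List ℕ) := [[], [2], [2, 0, 0]]

theorem insertion {M : Type*} [Monoid M] {p q : List ℕ} {y W1 W2 : M} (h : MSat M (sig p q))
    (h1 : LOK p y W1) (h2 : ROK q y W2) : W1 * W2 = W1 * (y * y) * W2 := by
  obtain ⟨L, T, h1⟩ := h1
  obtain ⟨R, s, h2⟩ := h2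
  have h3 := (msat_iff _).1 h (asg y T s)
  simp only [sig, wd, toList_ofList, ev_append, ev_cons, ev_nil, mul_one] at h3
  have h0 : asg y T s 0 = y := rfl
  rw [h0] at h3
  rw [h1 s, h2 T]
  calc _ = L * (ev (asg y T s) p * ev (asg y T s) q) * R := by simp only [mul_assoc]
    _ = _ := by rw [h3]; simp only [mul_assoc]

theorem LOK_some {M : Type*} [Monoid M] {g : ℕ → M} {x t : ℕ} {a b w : List ℕ} {y : M}
    (hs : a ++ t :: b ⊆ w) (hg : g x = y * y) :
    LOK (if x ∈ a then [0, 0, 1] else [1]) y (ev g w) := by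
  split_ifs with hx
  · have : x ∈ w := hs (by simp [hx])
    obtain ⟨c, d, rfl⟩ := List.append_of_mem this
    exact ⟨ev g c, ev g d, fun s => by simp [asg, hg, mul_assoc]⟩
  · exact ⟨1, ev g w, fun s => by simp [asg]⟩

theorem ROK_some {M : Type*} [Monoid M] {g : ℕ → M} {x t : ℕ} {c d : List ℕ} {y : M}
    (hg : g x = y * y) :
    ROK (if x ∈ d then [2, 0, 0] else [2]) y (ev g (c ++ t :: d)) := by
  split_ifs with hx
  · obtain ⟨d1, d2, rfl⟩ := List.append_of_mem hx
    exact ⟨ev g d2, ev g c * g t * ev g d1, fun T => by simp [asg, hg, mul_assoc]⟩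
  · exact ⟨1, ev g (c ++ t :: d), fun s => by simp [asg]⟩

theorem LOK_nil {M : Type*} [Monoid M] (y W : M) : LOK [] y W := ⟨W, 1, fun s => by simp⟩
theorem ROK_nil {M : Type*} [Monoid M] (y W : M) : ROK [] y W := ⟨W, 1, fun s => by simp⟩

theorem ev_update {M : Type*} [Monoid M] (h : ℕ → M) {t : ℕ} (A : M) {l : List ℕ} (hl : t ∉ l) :
    ev (Function.update h t A) l = ev h l := by
  apply ev_congr
  intro z hz
  rw [Function.update_of_ne]
  rintro rfl
  exact hl hz

theorem derL {N : Type*} [Monoid N] (h : ℕ → N) {a b u2 a' b' v2 : List ℕ} {t x : ℕ}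
    (HUV : ∀ f : ℕ → N, ev f ((a ++ t :: b) ++ u2) = ev f ((a' ++ t :: b') ++ x :: v2))
    (h1 : t ∉ a) (h2 : t ∉ b) (h3 : t ∉ u2) (h4 : t ∉ a') (h5 : t ∉ b') (h6 : t ∉ v2) (h7 : t ≠ x)
    (hX : h x * h x = h x) (hb : ev h b = 1) (hb' : ev h b' * h x = h x) :
    ev h a * h t * ev h u2 = ev h a * h t * h x * ev h u2 := by
  have e1 := HUV h
  have e2 := HUV (Function.update h t (h t * h x))
  simp only [ev_append, ev_cons, ev_update h _ h1, ev_update h _ h2, ev_update h _ h3,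
    ev_update h _ h4, ev_update h _ h5, ev_update h _ h6, Function.update_self,
    Function.update_of_ne h7.symm, hb, mul_one] at e1 e2
  have e3 : ev h a' * (h t * ev h b') * (h x * ev h v2)
      = ev h a' * (h t * h x * ev h b') * (h x * ev h v2) := by
    calc _ = ev h a' * h t * (ev h b' * h x) * ev h v2 := by simp only [mul_assoc]
      _ = ev h a' * h t * h x * (ev h b' * h x) * ev h v2 := by
        rw [hb', mul_assoc _ (h x) (h x), hX]
      _ = _ := by simp only [mul_assoc]
  rw [e1, e3, ← e2]
  simp only [mul_assoc]

theorem derR {N : Type*} [Monoid N] (h : ℕ → N) {u1 c d v1 c' d' : List ℕ} {t x : ℕ}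
    (HUV : ∀ f : ℕ → N, ev f (u1 ++ (c ++ t :: d)) = ev f (v1 ++ x :: (c' ++ t :: d')))
    (h1 : t ∉ c) (h2 : t ∉ d) (h3 : t ∉ u1) (h4 : t ∉ c') (h5 : t ∉ d') (h6 : t ∉ v1) (h7 : t ≠ x)
    (hX : h x * h x = h x) (hb : ev h c = 1) (hb' : h x * ev h c' = h x) :
    ev h u1 * (h t * ev h d) = ev h u1 * h x * (h t * ev h d) := by
  have e1 := HUV h
  have e2 := HUV (Function.update h t (h x * h t))
  simp only [ev_append, ev_cons, ev_update h _ h1, ev_update h _ h2, ev_update h _ h3,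
    ev_update h _ h4, ev_update h _ h5, ev_update h _ h6, Function.update_self,
    Function.update_of_ne h7.symm, hb, one_mul] at e1 e2
  have e3 : ev h v1 * (h x * (ev h c' * (h t * ev h d')))
      = ev h v1 * (h x * (ev h c' * (h x * h t * ev h d'))) := by
    calc _ = ev h v1 * (h x * ev h c') * (h t * ev h d') := by simp only [mul_assoc]
      _ = ev h v1 * (h x * ev h c' * h x) * (h t * ev h d') := by
        rw [hb', hX]
      _ = _ := by simp only [mul_assoc]
  rw [e1, e3, ← e2]
  simp only [mul_assoc]

/-- The substitution used to extract one of the finitely many identities. -/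
def hsub {N : Type*} [Monoid N] (x : ℕ) (ot os : Option ℕ) (y T s : N) : ℕ → N := fun z =>
  if z = x then y * y else if some z = ot then T else if some z = os then s else 1

theorem claimC {U V : List ℕ} {S : ℕ → Bool}
    (hS : ∀ z, S z = true → U.count z = 1 ∧ V.count z = 1) (hUV : ∀ x ∈ V, x ∈ U)
    (hf : U.filter S = V.filter S)
    {u1 u2 v1 v2 : List ℕ} {x : ℕ} (hx : S x = false) (hU : U = u1 ++ u2) (hV : V = v1 ++ x :: v2)
    (hf1 : u1.filter S = v1.filter S) (hl : ¬ InLast S x u1) (hr : ¬ InFirst S x u2) :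
    ∃ p ∈ PL, ∃ q ∈ QL,
      (∀ (N : Type uM) [Monoid N], InQ N → (∀ f : ℕ → N, ev f U = ev f V) → MSat N (sig p q)) ∧
      (∀ (M : Type uM) [Monoid M] (g : ℕ → M) (y : M) (w1 : List ℕ), u1 ⊆ w1 → g x = y * y →
        LOK p y (ev g w1)) ∧
      (∀ (M : Type uM) [Monoid M] (g : ℕ → M) (y : M), g x = y * y → ROK q y (ev g u2)) := by
  have hf2 : u2.filter S = v2.filter S := by
    rw [hU, hV, List.filter_append, List.filter_append, hf1] at hf
    have := List.append_cancel_left hf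
    rw [this, List.filter_cons_of_neg (by simp [hx])]
  have hxU : x ∈ U := hUV x (by simp [hV])
  have hmul : ∀ {t}, S t = true → t ≠ x := by
    rintro t ht rfl
    simp [ht] at hx
  rcases lastBlock S u1 with h1 | ⟨a, t, b, h1, ht, hb⟩
  · -- no divider on the left
    have hx1 : x ∉ u1 := by
      intro h
      obtain ⟨c, d, rfl⟩ := List.append_of_mem h
      exact hl ⟨c, d, rfl, fun z hz => h1 z (by simp [hz])⟩
    rcases firstBlock S u2 with h2 | ⟨c, s, d, h2, hs, hc⟩
    · exfalso
      have hx2 : x ∉ u2 := by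
        intro h
        obtain ⟨c, d, rfl⟩ := List.append_of_mem h
        exact hr ⟨c, d, rfl, fun z hz => h2 z (by simp [hz])⟩
      rw [hU, List.mem_append] at hxU
      tauto
    · have hxc : x ∉ c := by
        intro h
        obtain ⟨c1, c2, rfl⟩ := List.append_of_mem h
        exact hr ⟨c1, c2 ++ s :: d, by simp [h2], fun z hz => hc z (by simp [hz])⟩
      subst h2
      obtain ⟨c', d', rfl, hc'⟩ := first_match hs hc hf2
      have n1 := not_mem_of_count (a := u1 ++ c) (b := d) (t := s)
        (by have := (hS s hs).1; rw [hU] at this; simpa using this)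
      have n2 := not_mem_of_count (a := v1 ++ x :: c') (b := d') (t := s)
        (by have := (hS s hs).2; rw [hV] at this; simpa using this)
      simp only [List.mem_append, List.mem_cons, not_or] at n1 n2
      refine ⟨[], by simp [PL], if x ∈ d then [2, 0, 0] else [2], by split_ifs <;> simp [QL], ?_,
        fun M _ g y w1 _ _ => LOK_nil _ _, fun M _ g y hg => ROK_some hg⟩
      intro N _ hQ HUV
      rw [msat_iff]
      intro f
      set h : ℕ → N := hsub x none (some s) (f 0) (f 1) (f 2) with hh
      have hhx : h x = f 0 * f 0 := by simp [hh, hsub]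
      have hhs : h s = f 2 := by simp [hh, hsub, hmul hs]
      have hho : ∀ z, z ≠ s → z ≠ x → h z = 1 := by
        intro z hz1 hz2; simp [hh, hsub, hz1, hz2]
      have hX : h x * h x = h x := by rw [hhx]; exact hQ.idem _
      rw [hU, hV] at HUV
      have key := derR h HUV n1.1.2 n1.2 n1.1.1 n2.1.2.2 n2.2 n2.1.1 (hmul hs) hX
        (ev_one fun z hz => hho z (fun e => n1.1.2 (e ▸ hz)) (fun e => hxc (e ▸ hz)))
        (by
          rw [ev_single hX (fun z hz hzx => hho z (fun e => n2.1.2.2 (e ▸ hz)) hzx)]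
          split_ifs <;> simp [hX])
      rw [ev_one (l := u1) fun z hz => hho z (fun e => n1.1.1 (e ▸ hz)) (fun e => hx1 (e ▸ hz)),
        ev_single (l := d) hX (fun z hz hzx => hho z (fun e => n1.2 (e ▸ hz)) hzx), hhx, hhs] at key
      split_ifs with hd <;> simpa [hd, sig, wd, mul_assoc] using key
  · have hxb : x ∉ b := by
      intro h
      obtain ⟨b1, b2, rfl⟩ := List.append_of_mem h
      exact hl ⟨a ++ t :: b1, b2, by simp [h1], fun z hz => hb z (by simp [hz])⟩
    subst h1
    obtain ⟨a', b', rfl, hb'⟩ := last_match ht hb hf1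
    have n1 := not_mem_of_count (a := a) (b := b ++ u2) (t := t)
      (by have := (hS t ht).1; rw [hU] at this; simpa using this)
    have n2 := not_mem_of_count (a := a') (b := b' ++ x :: v2) (t := t)
      (by have := (hS t ht).2; rw [hV] at this; simpa using this)
    simp only [List.mem_append, List.mem_cons, not_or] at n1 n2
    rcases firstBlock S u2 with h2 | ⟨c, s, d, h2, hs, hc⟩
    · have hx2 : x ∉ u2 := by
        intro h
        obtain ⟨c, d, rfl⟩ := List.append_of_mem h
        exact hr ⟨c, d, rfl, fun z hz => h2 z (by simp [hz])⟩
      refine ⟨if x ∈ a then [0, 0, 1] else [1], by split_ifs <;> simp [PL], [], by simp [QL], ?_,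
        fun M _ g y w1 hw hg => LOK_some hw hg, fun M _ g y hg => ROK_nil _ _⟩
      intro N _ hQ HUV
      rw [msat_iff]
      intro f
      set h : ℕ → N := hsub x (some t) none (f 0) (f 1) (f 2) with hh
      have hhx : h x = f 0 * f 0 := by simp [hh, hsub]
      have hht : h t = f 1 := by simp [hh, hsub, hmul ht]
      have hho : ∀ z, z ≠ t → z ≠ x → h z = 1 := by
        intro z hz1 hz2; simp [hh, hsub, hz1, hz2]
      have hX : h x * h x = h x := by rw [hhx]; exact hQ.idem _
      rw [hU, hV] at HUV
      have key := derL h HUV n1.1 n1.2.1 n1.2.2 n2.1 n2.2.1 n2.2.2.2 (hmul ht) hX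
        (ev_one fun z hz => hho z (fun e => n1.2.1 (e ▸ hz)) (fun e => hxb (e ▸ hz)))
        (by
          rw [ev_single hX (fun z hz hzx => hho z (fun e => n2.2.1 (e ▸ hz)) hzx)]
          split_ifs <;> simp [hX])
      rw [ev_one (l := u2) fun z hz => hho z (fun e => n1.2.2 (e ▸ hz)) (fun e => hx2 (e ▸ hz)),
        ev_single (l := a) hX (fun z hz hzx => hho z (fun e => n1.1 (e ▸ hz)) hzx), hhx, hht] at key
      split_ifs with hd <;> simpa [hd, sig, wd, mul_assoc] using key
    · have hxc : x ∉ c := by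
        intro h
        obtain ⟨c1, c2, rfl⟩ := List.append_of_mem h
        exact hr ⟨c1, c2 ++ s :: d, by simp [h2], fun z hz => hc z (by simp [hz])⟩
      subst h2
      have n3 := not_mem_of_count (a := a ++ t :: b ++ c) (b := d) (t := s)
        (by have := (hS s hs).1; rw [hU] at this; simpa using this)
      simp only [List.mem_append, List.mem_cons, not_or] at n1 n2 n3
      refine ⟨if x ∈ a then [0, 0, 1] else [1], by split_ifs <;> simp [PL],
        if x ∈ d then [2, 0, 0] else [2], by split_ifs <;> simp [QL], ?_,
        fun M _ g y w1 hw hg => LOK_some hw hg, fun M _ g y hg => ROK_some hg⟩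
      intro N _ hQ HUV
      rw [msat_iff]
      intro f
      set h : ℕ → N := hsub x (some t) (some s) (f 0) (f 1) (f 2) with hh
      have hhx : h x = f 0 * f 0 := by simp [hh, hsub]
      have hht : h t = f 1 := by simp [hh, hsub, hmul ht]
      have hhs : h s = f 2 := by simp [hh, hsub, hmul hs, n3.1.1.2.1]
      have hho : ∀ z, z ≠ t → z ≠ s → z ≠ x → h z = 1 := by
        intro z hz1 hz2 hz3; simp [hh, hsub, hz1, hz2, hz3]
      have hX : h x * h x = h x := by rw [hhx]; exact hQ.idem _
      have hsV : b'.count s = 0 := by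
        apply List.count_eq_zero.2
        intro hm
        have := hb' s hm
        simp [hs] at this
      rw [hU, hV] at HUV
      have key := derL h HUV n1.1 n1.2.1 (by simpa using n1.2.2) n2.1 n2.2.1 n2.2.2.2 (hmul ht) hX
        (ev_one fun z hz => hho z (fun e => n1.2.1 (e ▸ hz)) (fun e => n3.1.1.2.2 (e ▸ hz))
          (fun e => hxb (e ▸ hz)))
        (by
          rw [ev_single hX (fun z hz hzx => hho z (fun e => n2.2.1 (e ▸ hz))
            (fun e => List.count_eq_zero.1 hsV (e ▸ hz)) hzx)]
          split_ifs <;> simp [hX])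
      rw [ev_append, ev_cons,
        ev_one (l := c) fun z hz => hho z (fun e => n1.2.2.1 (e ▸ hz)) (fun e => n3.1.2 (e ▸ hz))
          (fun e => hxc (e ▸ hz)),
        ev_single (l := a) hX (fun z hz hzx => hho z (fun e => n1.1 (e ▸ hz))
          (fun e => n3.1.1.1 (e ▸ hz)) hzx),
        ev_single (l := d) hX (fun z hz hzx => hho z (fun e => n1.2.2.2.2 (e ▸ hz))
          (fun e => n3.2 (e ▸ hz)) hzx), hhx, hht, hhs] at key
      by_cases hd : x ∈ d <;> by_cases ha : x ∈ a <;>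
        simpa [hd, ha, sig, wd, mul_assoc] using key

end sigma

theorem exists_swap : ∀ (l k : List ℕ), l.Nodup → k.Nodup → l.Perm k → l ≠ k →
    ∃ x y, x ≠ y ∧ [x, y].Sublist l ∧ [y, x].Sublist k := by
  intro l
  induction l with
  | nil =>
    intro k _ _ hp hne
    exact absurd hp.nil_eq hne
  | cons a l ih =>
    intro k hl hk hp hne
    cases k with
    | nil => exact absurd hp.eq_nil (by simp)
    | cons b k =>
      by_cases hab : a = b
      · subst hab
        obtain ⟨x, y, h, h1, h2⟩ := ih k (List.nodup_cons.1 hl).2 (List.nodup_cons.1 hk).2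
          (List.Perm.cons_inv hp) (fun e => hne (by rw [e]))
        exact ⟨x, y, h, h1.cons _, h2.cons _⟩
      · have hb : b ∈ l := by
          have : b ∈ a :: l := hp.mem_iff.2 (by simp)
          rcases List.mem_cons.1 this with h | h
          · exact absurd h.symm hab
          · exact h
        have ha : a ∈ k := by
          have : a ∈ b :: k := hp.mem_iff.1 (by simp)
          rcases List.mem_cons.1 this with h | h
          · exact absurd h hab
          · exact h
        exact ⟨a, b, hab, (List.singleton_sublist.2 hb).cons_cons a,
          (List.singleton_sublist.2 ha).cons_cons b⟩

theorem ev_filter {M : Type*} [Monoid M] (f : ℕ → M) (P : ℕ → Bool) (w : List ℕ)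
    (h : ∀ z, P z = false → f z = 1) : ev f w = ev f (w.filter P) := by
  induction w with
  | nil => simp
  | cons a w ih =>
    by_cases ha : P a
    · rw [List.filter_cons_of_pos ha, ev_cons, ev_cons, ih]
    · rw [List.filter_cons_of_neg ha, ev_cons, ih, h a (by simpa using ha), one_mul]

theorem filter_pair {x y : ℕ} (hxy : x ≠ y) {w : List ℕ} (hx : w.count x = 1) (hy : w.count y = 1)
    (h : [x, y].Sublist w) : w.filter (fun z => decide (z = x ∨ z = y)) = [x, y] := by
  have h1 := h.filter (fun z => decide (z = x ∨ z = y))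
  have h2 : [x, y].filter (fun z => decide (z = x ∨ z = y)) = [x, y] := by simp
  rw [h2] at h1
  refine (h1.eq_of_length ?_).symm
  have : ∀ w : List ℕ, (w.filter (fun z => decide (z = x ∨ z = y))).length
      = w.count x + w.count y := by
    intro w
    induction w with
    | nil => simp
    | cons a w ih =>
      rw [List.filter_cons, List.count_cons, List.count_cons]
      by_cases h1 : a = x
      · have h2 : a ≠ y := fun e => hxy (h1.symm.trans e)
        rw [if_pos (by simp [h1]), List.length_cons, ih, if_pos (by simp [h1]),
          if_neg (by simp [h2])]
        omega
      · by_cases h2 : a = y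
        · rw [if_pos (by simp [h2]), List.length_cons, ih, if_neg (by simp [h1]),
            if_pos (by simp [h2])]
          omega
        · rw [if_neg (by simp [h1, h2]), ih, if_neg (by simp [h1]), if_neg (by simp [h2])]
          omega
  rw [this, hx, hy]
  rfl

/-- The finite list of relevant identities. -/
def FS : Set (Word × Word) :=
  {(wd [0], wd []), (wd [0], wd [0, 0]), (wd [0, 1], wd [1, 0])} ∪
    {e | ∃ p ∈ PL, ∃ q ∈ QL, e = sig p q}

theorem FS_finite : FS.Finite := by
  refine Set.Finite.union (by simp) ?_
  refine (((List.finite_toSet PL).prod (List.finite_toSet QL)).image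
    (fun r => sig r.1 r.2)).subset ?_
  rintro e ⟨p, hp, q, hq, rfl⟩
  exact ⟨(p, q), ⟨hp, hq⟩, rfl⟩

theorem pow_one_triv {N : Type*} [Monoid N] (hQ : InQ N) {a : N} {k : ℕ} (hk : 1 ≤ k)
    (h : a ^ k = 1) : a = 1 := by
  have h2 : a * a = 1 := by
    rw [← hQ.pow' a (k := k * 2) (by omega), pow_mul, h, one_pow]
  have := hQ.cube a
  rw [h2, one_mul] at this
  exact this.symm

theorem half {M : Type uM} [Monoid M] (hQ : InQ M) (u v : List ℕ)
    (H : ∀ e ∈ FS, (∀ (N : Type uM) [Monoid N], InQ N → (∀ f : ℕ → N, ev f u = ev f v) →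
      MSat N e) → MSat M e)
    (S : ℕ → Bool) (hS : ∀ z, S z = true → u.count z = 1 ∧ v.count z = 1)
    (hS2 : ∀ x ∈ u, S x = false → 2 ≤ u.count x)
    (hc : ∀ x ∈ v, x ∈ u) (hf : u.filter S = v.filter S) {w : List ℕ} (hm : Merge S u v w)
    (f : ℕ → M) : ev f u = ev (fun z => if S z then f z else f z * f z) w := by
  rw [sq_all hQ f u S hS2]
  set g : ℕ → M := fun z => if S z then f z else f z * f z with hg
  have hgx : ∀ x, S x = false → g x = f x * f x := by
    intro x hx; simp [hg, hx]
  have key := progress (g := g) (S := S) (U := u) (V := v)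
    (fun x hx => by rw [hgx x hx]; exact hQ.idem _)
    (fun x y hx hy => by rw [hgx x hx, hgx y hy]; exact hQ.comm _ _)
    (by
      intro u1 u2 v1 v2 x hx hU hV hf1
      by_cases hl : InLast S x u1
      · exact Or.inl hl
      by_cases hr : InFirst S x u2
      · exact Or.inr (Or.inl hr)
      obtain ⟨p, hp, q, hq, h1, h2, h3⟩ := claimC.{uM} hS hc hf hx hU hV hf1 hl hr
      have hs := H (sig p q) (Or.inr ⟨p, hp, q, hq, rfl⟩) h1
      refine Or.inr (Or.inr fun w1 hw => ?_)
      rw [hgx x hx]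
      exact insertion hs (h2 M g _ w1 hw (hgx x hx)) (h3 M g _ (hgx x hx)))
    hm [] [] [] rfl rfl rfl (by simp) (by
      rintro x _ ⟨c, d, h, _⟩
      simp at h)
  simpa using key

theorem core {M : Type uM} [Monoid M] (hQ : InQ M) (u v : List ℕ)
    (H : ∀ e ∈ FS, (∀ (N : Type uM) [Monoid N], InQ N → (∀ f : ℕ → N, ev f u = ev f v) →
      MSat N e) → MSat M e) (f : ℕ → M) : ev f u = ev f v := by
  by_cases h0 : ∃ x, (u.count x = 0 ∧ 1 ≤ v.count x) ∨ (v.count x = 0 ∧ 1 ≤ u.count x)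
  · obtain ⟨x, hx⟩ := h0
    have h1 := H (wd [0], wd []) (by simp [FS]) (by
      intro N _ hN hs
      rw [msat_iff]
      intro f
      have := hs (fun z => if z = x then f 0 else 1)
      rw [ev_pow, ev_pow] at this
      have : f 0 = 1 := by
        rcases hx with ⟨h, h'⟩ | ⟨h, h'⟩
        · rw [h, pow_zero] at this
          exact pow_one_triv hN h' this.symm
        · rw [h, pow_zero] at this
          exact pow_one_triv hN h' this
      simp [wd, this])
    rw [msat_iff] at h1
    have h2 : ∀ a : M, a = 1 := fun a => by simpa [wd] using h1 (fun _ => a)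
    rw [h2 (ev f u), h2 (ev f v)]
  by_cases h1 : ∃ x, (u.count x = 1 ∧ 2 ≤ v.count x) ∨ (v.count x = 1 ∧ 2 ≤ u.count x)
  · obtain ⟨x, hx⟩ := h1
    have h1 := H (wd [0], wd [0, 0]) (by simp [FS]) (by
      intro N _ hN hs
      rw [msat_iff]
      intro f
      have := hs (fun z => if z = x then f 0 else 1)
      rw [ev_pow, ev_pow] at this
      have : f 0 = f 0 * f 0 := by
        rcases hx with ⟨h, h'⟩ | ⟨h, h'⟩
        · rwa [h, pow_one, hN.pow' _ h'] at this
        · rw [h, pow_one, hN.pow' _ h'] at this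
          exact this.symm
      simpa [wd] using this)
    rw [msat_iff] at h1
    have h2 : ∀ a : M, a * a = a := fun a => by simpa [wd] using (h1 (fun _ => a)).symm
    refine comm_case (fun a b => ?_) u v ?_ f
    · have := hQ.comm a b
      rwa [h2, h2] at this
    · intro y a
      have hp : ∀ k, 1 ≤ k → a ^ k = a := by
        intro k hk
        rcases Nat.lt_or_ge k 2 with h | h
        · have : k = 1 := by omega
          subst this
          simp
        · rw [hQ.pow' a h, h2]
      push Not at h0
      have := h0 y
      by_cases hu : u.count y = 0
      · have : v.count y = 0 := by omega
        rw [hu, this]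
      · rw [hp _ (by omega), hp _ (by omega)]
  push Not at h0 h1
  have hcnt : ∀ x, u.count x = v.count x ∨ (2 ≤ u.count x ∧ 2 ≤ v.count x) := by
    intro x
    have := h0 x
    have := h1 x
    omega
  let S : ℕ → Bool := fun z => decide (u.count z = 1)
  have hS : ∀ z, S z = true → u.count z = 1 ∧ v.count z = 1 := by
    intro z hz
    have hz : u.count z = 1 := by simpa [S] using hz
    have := hcnt z
    omega
  have hmem : ∀ x, x ∈ u ↔ x ∈ v := by
    intro x
    rw [← List.count_pos_iff, ← List.count_pos_iff]
    have := hcnt x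
    omega
  by_cases hf : u.filter S = v.filter S
  · obtain ⟨w, hw⟩ := exists_merge S u v hf
    have hS2 : ∀ x, S x = false → u.count x ≠ 1 := by
      intro x hx
      simpa [S] using hx
    rw [half hQ u v H S hS ?_ (fun x => (hmem x).2) hf hw f,
      half hQ v u ?_ S (fun z hz => (hS z hz).symm) ?_ (fun x => (hmem x).1) hf.symm hw.symm f]
    · intro e he h
      exact H e he (fun N _ hN hs => h N hN (fun f => (hs f).symm))
    · intro x hx hx'
      have h1 := List.count_pos_iff.2 hx
      have h2 := hS2 x hx'
      have := hcnt x
      omega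
    · intro x hx hx'
      have h1 := List.count_pos_iff.2 hx
      have h2 := hS2 x hx'
      omega
  · -- some pair of simple letters is swapped
    have nd : ∀ w : List ℕ, (∀ z, S z = true → w.count z = 1) → (w.filter S).Nodup := by
      intro w hw
      rw [List.nodup_iff_count_le_one]
      intro z
      by_cases hz : S z
      · rw [List.count_filter hz, hw z hz]
      · rw [List.count_eq_zero.2]
        · omega
        · simp [hz]
    have hp : (u.filter S).Perm (v.filter S) := by
      rw [List.perm_ext_iff_of_nodup (nd u fun z hz => (hS z hz).1) (nd v fun z hz => (hS z hz).2)]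
      intro z
      simp [hmem z]
    obtain ⟨x, y, hxy, s1, s2⟩ := exists_swap _ _ (nd u fun z hz => (hS z hz).1)
      (nd v fun z hz => (hS z hz).2) hp hf
    have hSx : S x = true := (List.mem_filter.1 (s1.subset (by simp : x ∈ [x, y]))).2
    have hSy : S y = true := (List.mem_filter.1 (s1.subset (by simp : y ∈ [x, y]))).2
    have f1 := filter_pair hxy (hS x hSx).1 (hS y hSy).1 (s1.trans List.filter_sublist)
    have f2 := filter_pair hxy.symm (hS y hSy).2 (hS x hSx).2 (s2.trans List.filter_sublist)
    have hcm := H (wd [0, 1], wd [1, 0]) (by simp [FS]) (by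
      intro N _ hN hs
      rw [msat_iff]
      intro f
      have := hs (fun z => if z = x then f 0 else if z = y then f 1 else 1)
      rw [ev_filter _ (fun z => decide (z = x ∨ z = y)) u, f1,
        ev_filter _ (fun z => decide (z = y ∨ z = x)) v, f2] at this
      · simpa [wd, hxy, hxy.symm] using this
      · intro z hz
        simp at hz
        simp [hz]
      · intro z hz
        simp at hz
        simp [hz])
    rw [msat_iff] at hcm
    refine comm_case (fun a b => ?_) u v ?_ f
    · simpa [wd] using hcm (fun n => if n = 0 then a else b)
    · intro z a
      rcases hcnt z with h | ⟨h, h'⟩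
      · rw [h]
      · rw [hQ.pow' a h, hQ.pow' a h']

end QHFB

/-- The variety `Q = Mod {xyx ≈ xyx², x²y² ≈ y²x², xyx ≈ x²yx}` is hereditarily
finitely based: every variety `Mod (Qset ∪ S)` is finitely based. -/
theorem Q_is_hereditarily_finitely_based (S : Set (Word × Word)) :
    ∃ T : Finset (Word × Word), ∀ (M : Type uM) [Monoid M],
      SatAll M (Qset ∪ S) ↔ SatAll M (↑T) := by
  classical
  let I : Set (Word × Word) := {e | e ∈ QHFB.FS ∧
    ∀ (N : Type uM) [Monoid N], SatAll N (Qset ∪ S) → MSat N e}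
  have hfin : (Qset ∪ I).Finite := by
    refine Set.Finite.union (by simp [Qset]) (QHFB.FS_finite.subset ?_)
    exact fun e he => he.1
  refine ⟨hfin.toFinset, fun M _ => ?_⟩
  rw [Set.Finite.coe_toFinset]
  constructor
  · intro h e he
    rcases he with he | he
    · exact h e (Or.inl he)
    · exact he.2 M h
  · intro h e he
    rcases he with he' | he'
    · exact h e (Or.inl he')
    have hQ : QHFB.InQ M := QHFB.inQ_iff.1 (fun e he => h e (Or.inl he))
    rw [QHFB.msat_iff]
    refine QHFB.core hQ _ _ ?_
    intro d hd himp
    refine h d (Or.inr ⟨hd, fun N _ hN => himp N ?_ ?_⟩)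
    · exact QHFB.inQ_iff.1 (fun e he => hN e (Or.inl he))
    · exact (QHFB.msat_iff e).1 (hN e (Or.inr he'))
end

section
/- Let V = Mod(Σ) be a variety of monoids that satisfies the identities xyx ≈ xyx² and x²y² ≈ y²x². If the variety E = Mod{x²y² ≈ y²x², x² ≈ x³, yx² ≈ xyx} is not contained in V (i.e., some monoid satisfying the defining identities of E fails some identity of Σ), then V is contained in K = Mod{xyx ≈ xyx², x²y² ≈ y²x², x²y ≈ x²yx}, i.e., every monoid satisfying Σ satisfies xyx ≈ xyx², x²y² ≈ y²x², and x²y ≈ x²yx. -/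
open FreeMonoid

section Helpers

theorem prod_eq_of_perm_comm {N : Type*} [Monoid N] (f : ℕ → N) :
    ∀ l1 l2 : List ℕ, l1.Perm l2 →
      (∀ a b, a ≠ b → List.Sublist [a, b] l1 → List.Sublist [b, a] l2 → Commute (f a) (f b)) →
      (l1.map f).prod = (l2.map f).prod := by
  intro l1
  induction l1 with
  | nil => intro l2 h _; rw [List.nil_perm.mp h]
  | cons a t ih =>
    intro l2 h H
    have ha : a ∈ l2 := h.subset (by simp)
    obtain ⟨p, q, rfl⟩ := List.append_of_mem ha
    have hp : t.Perm (p ++ q) := by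
      have := h.trans (List.perm_middle)
      exact (List.perm_cons a).mp this
    have key : ∀ b ∈ p, Commute (f a) (f b) := by
      intro b hb
      by_cases hab : a = b
      · rw [hab]
      · refine H a b hab ?_ ?_
        · refine List.Sublist.cons_cons a ?_
          exact List.singleton_sublist.mpr (hp.symm.subset (by simp [hb]))
        · have h1 : List.Sublist [b] p := List.singleton_sublist.mpr hb
          have h2 : List.Sublist [a] (a :: q) := List.singleton_sublist.mpr (by simp)
          exact h1.append h2
    have hc : Commute (f a) (p.map f).prod := by
      apply Commute.list_prod_right
      intro x hx
      obtain ⟨b, hb, rfl⟩ := List.mem_map.mp hx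
      exact key b hb
    have := ih (p ++ q) hp (by
      intro c d hcd h1 h2
      refine H c d hcd (h1.cons a) (h2.trans ?_)
      exact (List.Sublist.refl p).append (List.sublist_cons_self a q))
    simp only [List.map_cons, List.prod_cons, List.map_append, List.prod_append] at this ⊢
    rw [this, ← mul_assoc, hc.eq, mul_assoc]

theorem nf_E {N : Type*} [Monoid N] (g : ℕ → N)
    (e1 : ∀ x : N, x * x = x * x * x) (e2 : ∀ x y : N, y * x * x = x * y * x) :
    ∀ w : List ℕ, (w.map g).prod = (w.dedup.map fun c => g c ^ min 2 (w.count c)).prod := by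
  intro w
  induction w with
  | nil => simp
  | cons a w ih =>
    rw [List.map_cons, List.prod_cons, ih]
    by_cases ha : a ∈ w
    · rw [List.dedup_cons_of_mem ha]
      obtain ⟨p, q, hpq⟩ := List.append_of_mem (List.mem_dedup.mpr ha)
      have hn := List.nodup_dedup w
      rw [hpq] at hn ⊢
      have hnp : ∀ c ∈ p, c ≠ a := by
        intro c hc hca
        subst hca
        have := List.disjoint_of_nodup_append hn
        exact this hc (by simp)
      have hnq : ∀ c ∈ q, c ≠ a := by
        intro c hc hca
        subst hca
        have := (List.nodup_append.mp hn).2.1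
        exact (List.nodup_cons.mp this).1 hc
      have hP : (p.map fun c => g c ^ min 2 ((a :: w).count c))
          = p.map fun c => g c ^ min 2 (w.count c) := by
        apply List.map_congr_left
        intro c hc
        rw [List.count_cons_of_ne (hnp c hc).symm]
      have hQ : (q.map fun c => g c ^ min 2 ((a :: w).count c))
          = q.map fun c => g c ^ min 2 (w.count c) := by
        apply List.map_congr_left
        intro c hc
        rw [List.count_cons_of_ne (hnq c hc).symm]
      simp only [List.map_cons, List.prod_cons, List.map_append, List.prod_append, hP, hQ]
      have hpos : 1 ≤ w.count a := List.one_le_count_iff.mpr ha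
      rw [List.count_cons_self]
      have h2 : min 2 (w.count a + 1) = 2 := by omega
      rw [h2]
      generalize (p.map fun c => g c ^ min 2 (w.count c)).prod = P
      generalize (q.map fun c => g c ^ min 2 (w.count c)).prod = Q
      have hm : min 2 (w.count a) = 1 ∨ min 2 (w.count a) = 2 := by omega
      have hx : g a * P * g a ^ min 2 (w.count a) = P * g a ^ 2 := by
        rcases hm with hm | hm
        · rw [hm, pow_one, pow_two, ← mul_assoc, e2]
        · rw [hm, pow_two, ← mul_assoc, ← e2, mul_assoc, mul_assoc, ← mul_assoc (g a), ← e1]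
      rw [← mul_assoc P (g a ^ 2) Q, ← hx]
      simp only [mul_assoc]
    · rw [List.dedup_cons_of_notMem ha, List.map_cons, List.prod_cons]
      have h0 : w.count a = 0 := List.count_eq_zero.mpr ha
      rw [List.count_cons_self, h0]
      congr 1
      · simp
      · congr 1
        apply List.map_congr_left
        intro c hc
        have : a ≠ c := by rintro rfl; exact ha (List.mem_dedup.mp hc)
        rw [List.count_cons_of_ne this]

theorem map_prod_one {M : Type*} [Monoid M] (g : ℕ → M) (b : ℕ) (w : List ℕ)
    (h : ∀ c ∈ w, c ≠ b → g c = 1) : (w.map g).prod = g b ^ w.count b := by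
  induction w with
  | nil => simp
  | cons c w ih =>
    rw [List.map_cons, List.prod_cons, ih (fun d hd => h d (by simp [hd]))]
    by_cases hc : c = b
    · subst hc; rw [List.count_cons_self, pow_succ']
    · rw [List.count_cons_of_ne hc, h c (by simp) hc, one_mul]

theorem split_once (w : List ℕ) (a : ℕ) (h : w.count a = 1) :
    ∃ p q, w = p ++ a :: q ∧ a ∉ p ∧ a ∉ q := by
  have ha : a ∈ w := List.one_le_count_iff.mp h.ge
  obtain ⟨p, q, rfl⟩ := List.append_of_mem ha
  rw [List.count_append, List.count_cons_self] at h
  exact ⟨p, q, rfl, List.count_eq_zero.mp (by omega), List.count_eq_zero.mp (by omega)⟩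

theorem sub_after {a b : ℕ} (hab : a ≠ b) : ∀ (p q : List ℕ), a ∉ p → 
    List.Sublist [a, b] (p ++ a :: q) → b ∈ q := by
  intro p q hp h
  induction p with
  | nil =>
    have := (List.cons_sublist_cons.mp h)
    exact List.singleton_sublist.mp this
  | cons c p ih =>
    simp only [List.mem_cons, not_or] at hp
    refine ih hp.2 ?_
    rw [List.cons_append] at h
    rcases List.sublist_cons_iff.mp h with h | ⟨r, hr, _⟩
    · exact h
    · simp only [List.cons.injEq] at hr; exact absurd hr.1 hp.1

theorem before_dedup {a b : ℕ} (hab : a ≠ b) (p q : List ℕ)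
    (h : List.Sublist [b, a] (p ++ a :: q).dedup) (haq : a ∉ q) : b ∉ q := by
  intro hb
  have hn := List.nodup_dedup (p ++ a :: q)
  have hd : List.Sublist (a :: q).dedup (p ++ a :: q).dedup := by
    clear h hn
    induction p with
    | nil => exact List.Sublist.refl _
    | cons c p ih =>
      refine ih.trans ?_
      rw [List.cons_append]
      by_cases hc : c ∈ p ++ a :: q
      · rw [List.dedup_cons_of_mem hc]
      · rw [List.dedup_cons_of_notMem hc]; exact List.sublist_cons_self _ _
  have h2 : List.Sublist [a, b] (p ++ a :: q).dedup := by
    refine List.Sublist.trans ?_ hd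
    rw [List.dedup_cons_of_notMem haq]
    exact List.Sublist.cons_cons a (List.singleton_sublist.mpr (List.mem_dedup.mpr hb))
  obtain ⟨r, s, hrs⟩ := List.append_of_mem (h2.subset (by simp : a ∈ [a, b]))
  rw [hrs] at h h2 hn
  have har : a ∉ r := fun hh => List.disjoint_of_nodup_append hn hh (by simp)
  have hbs := sub_after hab r s har h2
  have hbr : b ∉ r := fun hh => List.disjoint_of_nodup_append hn hh (by simp [hbs])
  have has : a ∉ s := (List.nodup_cons.mp (List.nodup_append.mp hn).2.1).1
  obtain ⟨s1, s2, rfl⟩ := List.append_of_mem hbs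
  have hr : b ∉ r ++ a :: s1 := by
    intro hh
    have : (r ++ a :: (s1 ++ b :: s2)) = (r ++ a :: s1) ++ b :: s2 := by simp
    rw [this] at hn
    exact List.disjoint_of_nodup_append hn hh (by simp)
  have := sub_after hab.symm (r ++ a :: s1) s2 hr (by simpa using h)
  exact has (by simp [this])

theorem pow_ge_two {M : Type*} [Monoid M] (c1 : ∀ x : M, x * x = x * x * x) (x : M) :
    ∀ k, 2 ≤ k → x ^ k = x * x := by
  intro k hk
  induction k, hk using Nat.le_induction with
  | base => exact pow_two x
  | succ n _ ih => rw [pow_succ, ih, ← c1]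

theorem order_case {M : Type*} [Monoid M] (c1 : ∀ x y : M, x * y * x = x * y * x * x)
    (u v : List ℕ) (a b : ℕ) (hab : a ≠ b) (hu : u.count a = 1) (hv : v.count a = 1)
    (h1 : List.Sublist [a, b] u.dedup) (h2 : List.Sublist [b, a] v.dedup)
    (huv : ∀ g : ℕ → M, (u.map g).prod = (v.map g).prod) :
    ∀ x y : M, x * x * y = x * x * y * x := by
  have c2 : ∀ x : M, x * x = x * x * x := fun x => by simpa using c1 x 1
  obtain ⟨p, q, rfl, hp, hq⟩ := split_once u a hu
  obtain ⟨p', q', rfl, hp', hq'⟩ := split_once v a hv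
  have hbq' := before_dedup hab p' q' h2 hq'
  have hbp' : b ∈ p' := by
    have := List.mem_dedup.mp (h2.subset (by simp : b ∈ [b, a]))
    simp only [List.mem_append, List.mem_cons] at this
    rcases this with h | h | h
    · exact h
    · exact absurd h.symm hab
    · exact absurd h hbq'
  have hbq : b ∈ q := sub_after hab p q hp (h1.trans (List.dedup_sublist _))
  have hj : 1 ≤ q.count b := List.one_le_count_iff.mpr hbq
  have key : ∀ x y : M, x ^ p.count b * y * x ^ q.count b = x ^ p'.count b * y := by
    intro x y
    have := huv (fun c => if c = a then y else if c = b then x else 1)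
    simp only [List.map_append, List.map_cons, List.prod_append, List.prod_cons] at this
    have gen : ∀ w : List ℕ, a ∉ w →
        (w.map (fun c => if c = a then y else if c = b then x else 1)).prod
          = x ^ w.count b := by
      intro w hw
      rw [map_prod_one _ b]
      · simp [hab.symm]
      · intro c hc hcb
        have : c ≠ a := by rintro rfl; exact hw hc
        simp [this, hcb]
    rw [gen p hp, gen q hq, gen p' hp', gen q' hq', List.count_eq_zero.mpr hbq'] at this
    simpa [mul_assoc] using this
  intro x y
  generalize p.count b = i at key
  generalize q.count b = j at key hj
  generalize p'.count b = k at key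
  have fin : x ^ k * y = x ^ k * y * x → x * x * y = x * x * y * x := by
    intro h
    have h' : x * x * (x ^ k * y) = x * x * (x ^ k * y * x) := congrArg _ h
    have e : x * x * x ^ k = x * x := by
      rw [← pow_two, ← pow_add, pow_ge_two c2 x _ (by omega), pow_two]
    rw [← mul_assoc, ← mul_assoc, ← mul_assoc, e] at h'
    exact h'
  by_cases hj2 : 2 ≤ j
  · apply fin
    rw [← key, mul_assoc (_ * y), ← pow_succ, pow_ge_two c2 x j hj2, pow_ge_two c2 x (j+1) (by omega)]
  · have : j = 1 := by omega
    subst this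
    rcases Nat.eq_zero_or_pos i with rfl | hi
    · have h3 := key (x * x) y
      have h4 : (x * x) ^ k * y = x * x * y := by
        rcases Nat.eq_zero_or_pos k with rfl | hk
        · have h5 := key x 1
          have h6 : x = 1 := by simpa using h5
          simp [h6]
        · rw [← pow_two, ← pow_mul, pow_ge_two c2 x (2*k) (by omega), pow_two]
      rw [h4] at h3
      simp only [pow_zero, one_mul, pow_one] at h3
      rw [← h3, mul_assoc, ← c2]
    · apply fin
      rw [← key]
      obtain ⟨i, rfl⟩ : ∃ n, i = n + 1 := ⟨i - 1, by omega⟩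
      have := c1 x y
      rw [pow_succ, pow_one]
      simp only [mul_assoc] at this ⊢
      rw [← this]

theorem count_case {M : Type*} [Monoid M] (c2 : ∀ x : M, x * x = x * x * x)
    (c3 : ∀ x y : M, x * x * y * y = y * y * x * x)
    (i k : ℕ) (h : ∀ x : M, x ^ i = x ^ k) (hik : min 2 i < min 2 k) :
    ∀ x y : M, x * x * y = x * x * y * x := by
  have hi : i = 0 ∨ i = 1 := by omega
  have hid : ∀ x : M, x * x = x := by
    rcases hi with rfl | rfl
    · intro x
      have h1 : x ^ k = 1 := by rw [← h x, pow_zero]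
      have h2 : x * x * x ^ k = x * x * x ^ (k - 1) := by
        rw [← pow_two, ← pow_add, ← pow_add, pow_ge_two c2 x (2 + k) (by omega),
          pow_ge_two c2 x (2 + (k - 1)) (by omega)]
      have h3 : x * x ^ (k - 1) = 1 := by
        rw [← pow_succ', show k - 1 + 1 = k by omega, h1]
      rw [h1, mul_one, mul_assoc, h3, mul_one] at h2
      exact h2
    · intro x
      rw [← pow_ge_two c2 x k (by omega), ← h x, pow_one]
  intro x y
  have := c3 x y
  simp only [hid, mul_assoc] at this
  rw [hid, mul_assoc, ← this, ← mul_assoc, hid]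

theorem lift_wd {M : Type*} [Monoid M] (φ : Word →* M) (w : Word) :
    φ w = ((toList w).map fun c => φ (of c)).prod := by
  rw [← FreeMonoid.lift_apply]
  congr 1
  exact FreeMonoid.hom_eq (by simp)

end Helpers

universe uM

/-- If a variety `Mod S` satisfies `xyx ≈ xyx²` and `x²y² ≈ y²x²` and does not
contain the variety `E`, then it is contained in `K`. -/
theorem contained_in_K_of_not_contains_E (S : Set (Word × Word))
    (h1 : ∀ (M : Type uM) [Monoid M], SatAll M S → MSat M (wd [0,1,0], wd [0,1,0,0]))
    (h2 : ∀ (M : Type uM) [Monoid M], SatAll M S → MSat M (wd [0,0,1,1], wd [1,1,0,0]))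
    (hE : ∃ (M : Type uM) (inst : Monoid M), @SatAll M inst Eset ∧ ¬ @SatAll M inst S) :
    ∀ (M : Type uM) [Monoid M], SatAll M S → SatAll M Kset := by
  intro M _ hM
  have q1 := h1 M hM
  have q2 := h2 M hM
  have ev : ∀ (x y : M) (l : List ℕ), FreeMonoid.lift (fun n => if n = 0 then x else y) (wd l)
      = (l.map (fun n => if n = 0 then x else y)).prod := fun x y l => FreeMonoid.lift_apply _ _
  have c1 : ∀ x y : M, x * y * x = x * y * x * x := by
    intro x y
    have := q1 (FreeMonoid.lift (fun n => if n = 0 then x else y))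
    simpa [ev, mul_assoc] using this
  have c3 : ∀ x y : M, x * x * y * y = y * y * x * x := by
    intro x y
    have := q2 (FreeMonoid.lift (fun n => if n = 0 then x else y))
    simpa [ev, mul_assoc] using this
  have c2 : ∀ x : M, x * x = x * x * x := fun x => by simpa using c1 x 1
  have main : ∀ x y : M, x * x * y = x * x * y * x := by
    by_contra hcon
    obtain ⟨N, inst, hNE, hNS⟩ := hE
    apply hNS
    rintro ⟨u, v⟩ he φ
    have huv : ∀ g : ℕ → M, ((toList u).map g).prod = ((toList v).map g).prod := by
      intro g
      have := hM _ he (FreeMonoid.lift g)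
      simpa [FreeMonoid.lift_apply] using this
    have evN : ∀ (x y : N) (l : List ℕ), FreeMonoid.lift (fun n => if n = 0 then x else y) (wd l)
      = (l.map (fun n => if n = 0 then x else y)).prod := fun x y l => FreeMonoid.lift_apply _ _
    have e0 : ∀ x y : N, x * x * y * y = y * y * x * x := by
      intro x y
      have := hNE (wd [0,0,1,1], wd [1,1,0,0]) (by simp [Eset])
        (FreeMonoid.lift (fun n => if n = 0 then x else y))
      simpa [evN, mul_assoc] using this
    have e1 : ∀ x : N, x * x = x * x * x := by
      intro x
      have := hNE (wd [0,0], wd [0,0,0]) (by simp [Eset])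
        (FreeMonoid.lift (fun n => if n = 0 then x else x))
      rw [evN, evN] at this
      simpa [mul_assoc] using this
    have e2 : ∀ x y : N, y * x * x = x * y * x := by
      intro x y
      have := hNE (wd [1,0,0], wd [0,1,0]) (by simp [Eset])
        (FreeMonoid.lift (fun n => if n = 0 then x else y))
      simpa [evN, mul_assoc] using this
    show φ u = φ v
    rw [lift_wd φ u, lift_wd φ v]
    generalize toList u = u at huv
    generalize toList v = v at huv
    have hpow : ∀ a, ∀ x : M, x ^ u.count a = x ^ v.count a := by
      intro a x
      have := huv (fun c => if c = a then x else 1)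
      rw [map_prod_one _ a u (by intro c _ hc; simp [hc]),
        map_prod_one _ a v (by intro c _ hc; simp [hc])] at this
      simpa using this
    have hcount : ∀ a, min 2 (u.count a) = min 2 (v.count a) := by
      intro a
      rcases lt_trichotomy (min 2 (u.count a)) (min 2 (v.count a)) with h | h | h
      · exact absurd (count_case c2 c3 _ _ (hpow a) h) hcon
      · exact h
      · exact absurd (count_case c2 c3 _ _ (fun x => (hpow a x).symm) h) hcon
    rw [nf_E _ e1 e2 u, nf_E _ e1 e2 v]
    simp only [← hcount]
    have hmem : ∀ a, a ∈ u ↔ a ∈ v := by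
      intro a
      have := hcount a
      rw [← List.one_le_count_iff, ← List.one_le_count_iff]
      omega
    apply prod_eq_of_perm_comm
    · rw [List.perm_ext_iff_of_nodup (List.nodup_dedup _) (List.nodup_dedup _)]
      simpa using hmem
    · intro a b hab s1 s2
      have ha : 1 ≤ u.count a := List.one_le_count_iff.mpr
        (List.mem_dedup.mp (s1.subset (by simp)))
      have hb : 1 ≤ u.count b := List.one_le_count_iff.mpr
        (List.mem_dedup.mp (s1.subset (by simp)))
      have hca := hcount a
      have hcb := hcount b
      have ha2 : 2 ≤ u.count a := by
        by_contra hlt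
        exact hcon (order_case c1 u v a b hab (by omega) (by omega) s1 s2 huv)
      have hb2 : 2 ≤ u.count b := by
        by_contra hlt
        exact hcon (order_case c1 v u b a hab.symm (by omega) (by omega) s2 s1
          (fun g => (huv g).symm))
      rw [min_eq_left ha2, min_eq_left hb2]
      show _ * _ = _ * _
      simpa [pow_two, mul_assoc] using e0 (φ (of a)) (φ (of b))
  intro e he
  simp only [Kset, Set.mem_insert_iff, Set.mem_singleton_iff] at he
  rcases he with rfl | rfl | rfl
  · exact q1
  · exact q2
  · intro φ
    have := main (φ (of 0)) (φ (of 1))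
    rw [lift_wd φ, lift_wd φ]
    simpa [wd, mul_assoc] using this
end

section
/- Let V = Mod(Σ) be a variety of monoids that satisfies the identities xyx ≈ xyx² and x²y² ≈ y²x². If the variety F₀ = Mod{xyx ≈ xyx², x²y² ≈ y²x², xyzxy ≈ yxzxy, x²y ≈ x²yx} is not contained in V (i.e., some monoid satisfying the defining identities of F₀ fails some identity of Σ), then V is contained in Q = Mod{xyx ≈ xyx², x²y² ≈ y²x², xyx ≈ x²yx}, i.e., every monoid satisfying Σ satisfies xyx ≈ xyx², x²y² ≈ y²x², and xyx ≈ x²yx. -/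
open FreeMonoid

universe uM

/-- The letters of `w` before the first occurrence of `t`. -/
def preL (t : ℕ) (w : List ℕ) : List ℕ := w.takeWhile (fun a => !decide (a = t))

theorem preL_not_mem {t : ℕ} {p : List ℕ} (q : List ℕ) (h : t ∉ p) :
    preL t (p ++ q) = p ++ preL t q := by
  unfold preL
  induction p with
  | nil => rfl
  | cons a p ih =>
    have h1 : a ≠ t := fun e => h (by simp [e])
    have h2 : t ∉ p := fun e => h (by simp [e])
    simp [h1, ih h2]

theorem preL_mem {t : ℕ} {p : List ℕ} (q : List ℕ) (h : t ∈ p) :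
    preL t (p ++ q) = preL t p := by
  unfold preL
  induction p with
  | nil => simp at h
  | cons a p ih =>
    by_cases h1 : a = t
    · simp [h1]
    · have h2 : t ∈ p := by
        rcases List.mem_cons.1 h with e | e
        · exact absurd e.symm h1
        · exact e
      simp [h1, ih h2]

theorem preL_self (t : ℕ) (q : List ℕ) : preL t (t :: q) = [] := by simp [preL]

theorem preL_cons_ne {t a : ℕ} (h : a ≠ t) (q : List ℕ) :
    preL t (a :: q) = a :: preL t q := by simp [preL, h]

/-- Agreement of the invariants. -/
def Agree (u v : List ℕ) : Prop :=
  (∀ x, min 2 (u.count x) = min 2 (v.count x)) ∧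
  ∀ t x, u.count t = 1 → min 2 ((preL t u).count x) = min 2 ((preL t v).count x)

theorem Agree.symm {u v : List ℕ} (h : Agree u v) : Agree v u := by
  refine ⟨fun x => (h.1 x).symm, fun t x ht => (h.2 t x ?_).symm⟩
  have := h.1 t
  omega

theorem Agree.trans {u v w : List ℕ} (h : Agree u v) (h' : Agree v w) : Agree u w := by
  refine ⟨fun x => (h.1 x).trans (h'.1 x), fun t x ht => (h.2 t x ht).trans (h'.2 t x ?_)⟩
  have := h.1 t
  omega

theorem agree_del {p : List ℕ} {x : ℕ} (q : List ℕ) (h : 2 ≤ p.count x) :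
    Agree (p ++ x :: q) (p ++ q) := by
  constructor
  · intro y
    by_cases e : x = y
    · subst e; simp only [List.count_append, List.count_cons_self]; omega
    · simp [e]
  · intro t y ht
    have hxt : x ≠ t := by
      rintro rfl
      simp only [List.count_append, List.count_cons_self] at ht
      omega
    by_cases hm : t ∈ p
    · rw [preL_mem _ hm, preL_mem _ hm]
    · rw [preL_not_mem _ hm, preL_not_mem _ hm, preL_cons_ne hxt]
      by_cases e : x = y
      · subst e; simp only [List.count_append, List.count_cons_self]; omega
      · simp [e]

theorem agree_swap {p q : List ℕ} {a b : ℕ} (ha : (p ++ a :: b :: q).count a ≠ 1)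
    (hb : (p ++ a :: b :: q).count b ≠ 1) :
    Agree (p ++ a :: b :: q) (p ++ b :: a :: q) := by
  have hp : ∀ r : List ℕ, (p ++ a :: b :: r).Perm (p ++ b :: a :: r) :=
    fun r => (List.Perm.swap b a r).append_left p
  constructor
  · intro y
    rw [(hp q).count_eq]
  · intro t y ht
    have hat : a ≠ t := by rintro rfl; exact ha ht
    have hbt : b ≠ t := by rintro rfl; exact hb ht
    by_cases hm : t ∈ p
    · rw [preL_mem _ hm, preL_mem _ hm]
    · rw [preL_not_mem _ hm, preL_not_mem _ hm, preL_cons_ne hat, preL_cons_ne hbt,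
        preL_cons_ne hbt, preL_cons_ne hat, (hp _).count_eq]

section Sem
variable {N : Type*} [Monoid N]

/-- Evaluation of a word. -/
def ev (f : ℕ → N) (w : List ℕ) : N := (w.map f).prod

theorem ev_append (f : ℕ → N) (u v : List ℕ) : ev f (u ++ v) = ev f u * ev f v := by
  simp [ev]

theorem ev_cons (f : ℕ → N) (a : ℕ) (v : List ℕ) : ev f (a :: v) = f a * ev f v := by
  simp [ev]

theorem ev_nil (f : ℕ → N) : ev f [] = 1 := by simp [ev]

/-- The identities of `F₀`, elementwise. -/
structure F0 (N : Type*) [Monoid N] : Prop where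
  A : ∀ x y : N, x * (y * x) = x * (y * (x * x))
  B : ∀ x y : N, x * (x * (y * y)) = y * (y * (x * x))
  C : ∀ x y z : N, x * (y * (z * (x * y))) = y * (x * (z * (x * y)))
  D : ∀ x y : N, x * (x * y) = x * (x * (y * x))

theorem absorb1 (H : F0 N) (f : ℕ → N) {p : List ℕ} {a : ℕ} (h : a ∈ p) (z : N) :
    ev f p * (z * f a) = ev f p * (z * (f a * f a)) := by
  obtain ⟨p1, p2, rfl⟩ := List.append_of_mem h
  simp only [ev_append, ev_cons, mul_assoc]
  have := H.A (f a) (ev f p2 * z)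
  simp only [mul_assoc] at this
  rw [this]

theorem absorb2 (H : F0 N) (f : ℕ → N) {p : List ℕ} {a : ℕ} (h : 2 ≤ p.count a) (z : N) :
    ev f p * (z * f a) = ev f p * z := by
  obtain ⟨p1, p2, rfl⟩ := List.append_of_mem (List.count_pos_iff.1 (by omega : 0 < p.count a))
  by_cases h1 : a ∈ p2
  · obtain ⟨p3, p4, rfl⟩ := List.append_of_mem h1
    simp only [ev_append, ev_cons, mul_assoc]
    have e1 : ∀ w : N, f a * (ev f p3 * (f a * w)) = f a * (ev f p3 * (f a * (f a * w))) := by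
      intro w
      have := congrArg (· * w) (H.A (f a) (ev f p3))
      simpa only [mul_assoc] using this
    have e2 := H.D (f a) (ev f p4 * z)
    simp only [mul_assoc] at e2
    rw [e1, ← e2, ← e1]
  · obtain ⟨p3, p4, rfl⟩ := List.append_of_mem
      (List.count_pos_iff.1 (by
        simp only [List.count_append, List.count_cons_self, List.count_eq_zero_of_not_mem h1] at h
        omega : 0 < p1.count a))
    simp only [ev_append, ev_cons, mul_assoc]
    have e1 : ∀ w : N, f a * (ev f p4 * (f a * w)) = f a * (ev f p4 * (f a * (f a * w))) := by
      intro w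
      have := congrArg (· * w) (H.A (f a) (ev f p4))
      simpa only [mul_assoc] using this
    have e2 := H.D (f a) (ev f p2 * z)
    simp only [mul_assoc] at e2
    rw [e1, ← e2, ← e1]

theorem ev_del (H : F0 N) (f : ℕ → N) {p : List ℕ} {a : ℕ} (q : List ℕ) (h : 2 ≤ p.count a) :
    ev f (p ++ a :: q) = ev f (p ++ q) := by
  have := absorb2 H f h 1
  rw [one_mul, mul_one] at this
  rw [ev_append, ev_cons, ← mul_assoc, this, ev_append]

theorem ev_swap_aux (H : F0 N) (f : ℕ → N) {p q : List ℕ} {a b : ℕ}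
    (h : ∃ q1 q2, q = q1 ++ b :: q2 ∧ 2 ≤ (p ++ a :: b :: q1).count a) :
    ev f (p ++ a :: b :: q) = ev f (p ++ b :: a :: q) := by
  obtain ⟨q1, q2, rfl, hc⟩ := h
  have hc' : 2 ≤ (p ++ b :: a :: q1).count a := by
    rwa [← ((List.Perm.swap b a q1).append_left p).count_eq]
  have e1 : ev f (p ++ a :: b :: (q1 ++ a :: b :: q2)) = ev f (p ++ a :: b :: (q1 ++ b :: q2)) := by
    have := ev_del H f (b :: q2) hc
    simpa using this
  have e2 : ev f (p ++ b :: a :: (q1 ++ a :: b :: q2)) = ev f (p ++ b :: a :: (q1 ++ b :: q2)) := by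
    have := ev_del H f (b :: q2) hc'
    simpa using this
  rw [← e1, ← e2]
  have := congrArg (fun w => ev f p * (w * ev f q2)) (H.C (f a) (f b) (ev f q1))
  simpa only [ev_append, ev_cons, mul_assoc] using this

theorem ev_swap (H : F0 N) (f : ℕ → N) {p q : List ℕ} {a b : ℕ}
    (ha : (p ++ a :: b :: q).count a ≠ 1)
    (hb : (p ++ a :: b :: q).count b ≠ 1) :
    ev f (p ++ a :: b :: q) = ev f (p ++ b :: a :: q) := by
  by_cases hab : a = b
  · rw [hab]
  have hba : b ≠ a := fun e => hab e.symm
  simp only [List.count_append, List.count_cons_self, List.count_cons_of_ne hab,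
    List.count_cons_of_ne hba] at ha hb
  by_cases pa : a ∈ p <;> by_cases pb : b ∈ p
  · have a1 := absorb1 H f pa 1
    have a2 := absorb1 H f pa (f b)
    have b1 := absorb1 H f pb 1
    have b2 := absorb1 H f pb (f a * f a)
    have b3 := absorb1 H f pb (f a)
    have a3 := absorb1 H f pa (f b * f b)
    simp only [one_mul, mul_assoc] at a1 a2 b1 b2 b3 a3
    have key : ev f p * (f a * f b) = ev f p * (f b * f a) := by
      have l : ev f p * (f a * f b) = ev f p * (f a * (f a * (f b * f b))) := by
        rw [← b2, ← mul_assoc, a1]; simp only [mul_assoc]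
      have r : ev f p * (f b * f a) = ev f p * (f b * (f b * (f a * f a))) := by
        rw [← a3, ← mul_assoc, b1]; simp only [mul_assoc]
      rw [l, r, H.B]
    have := congrArg (· * ev f q) key
    simpa only [ev_append, ev_cons, mul_assoc] using this
  · have qb : b ∈ q := by
      rw [List.count_eq_zero_of_not_mem pb] at hb
      exact List.count_pos_iff.1 (by omega)
    obtain ⟨q1, q2, rfl⟩ := List.append_of_mem qb
    refine ev_swap_aux H f ⟨q1, q2, rfl, ?_⟩
    have := List.count_pos_iff.2 pa
    simp only [List.count_append, List.count_cons_self]; omega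
  · have qa : a ∈ q := by
      rw [List.count_eq_zero_of_not_mem pa] at ha
      exact List.count_pos_iff.1 (by omega)
    obtain ⟨q1, q2, rfl⟩ := List.append_of_mem qa
    refine (ev_swap_aux H f ⟨q1, q2, rfl, ?_⟩).symm
    have := List.count_pos_iff.2 pb
    simp only [List.count_append, List.count_cons_self]; omega
  · have qa : a ∈ q := by
      rw [List.count_eq_zero_of_not_mem pa] at ha
      exact List.count_pos_iff.1 (by omega)
    have qb : b ∈ q := by
      rw [List.count_eq_zero_of_not_mem pb] at hb
      exact List.count_pos_iff.1 (by omega)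
    obtain ⟨q1, q2, rfl⟩ := List.append_of_mem qb
    by_cases h1 : a ∈ q1
    · refine ev_swap_aux H f ⟨q1, q2, rfl, ?_⟩
      have := List.count_pos_iff.2 h1
      simp only [List.count_append, List.count_cons_self, List.count_cons_of_ne hba]; omega
    · have h2 : a ∈ q2 := by
        simp only [List.mem_append, List.mem_cons] at qa
        tauto
      obtain ⟨q3, q4, rfl⟩ := List.append_of_mem h2
      refine (ev_swap_aux H f ⟨q1 ++ b :: q3, q4, by simp, ?_⟩).symm
      simp only [List.count_append, List.count_cons_self, List.count_cons_of_ne hab]; omega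

theorem ev_move (H : F0 N) (f : ℕ → N) {a : ℕ} {q : List ℕ} (r : List ℕ) :
    ∀ p : List ℕ, (p ++ r ++ a :: q).count a ≠ 1 →
    (∀ b ∈ r, (p ++ r ++ a :: q).count b ≠ 1) →
    Agree (p ++ r ++ a :: q) (p ++ a :: (r ++ q)) ∧
      ev f (p ++ r ++ a :: q) = ev f (p ++ a :: (r ++ q)) := by
  induction r with
  | nil => intro p _ _; rw [List.append_nil, List.nil_append]
           exact ⟨⟨fun _ => rfl, fun _ _ _ => rfl⟩, rfl⟩
  | cons b r ih =>
    intro p ha hb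
    have e : p ++ b :: r ++ a :: q = (p ++ [b]) ++ r ++ a :: q := by simp
    have e' : (p ++ [b]) ++ a :: (r ++ q) = p ++ b :: a :: (r ++ q) := by simp
    have hperm : ((p ++ b :: r) ++ a :: q).Perm (p ++ b :: a :: (r ++ q)) := by
      rw [e, ← e', List.append_assoc]
      exact List.Perm.append_left _ List.perm_middle
    obtain ⟨i1, i2⟩ := ih (p ++ [b]) (by rw [← e]; exact ha)
      (fun c hc => by rw [← e]; exact hb c (by simp [hc]))
    rw [e'] at i1 i2
    rw [← e] at i1 i2
    have ha' : (p ++ b :: a :: (r ++ q)).count a ≠ 1 := by rwa [← hperm.count_eq]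
    have hb' : (p ++ b :: a :: (r ++ q)).count b ≠ 1 := by
      rw [← hperm.count_eq]; exact hb b (by simp)
    exact ⟨i1.trans (agree_swap hb' ha'), i2.trans (ev_swap H f hb' ha')⟩

theorem ev_main (H : F0 N) (f : ℕ → N) : ∀ (n : ℕ) (p u v : List ℕ), u.length + v.length ≤ n →
    Agree (p ++ u) (p ++ v) → ev f (p ++ u) = ev f (p ++ v) := by
  intro n
  induction n with
  | zero =>
    intro p u v hn _
    have h1 : u = [] := List.length_eq_zero_iff.1 (by omega)
    have h2 : v = [] := List.length_eq_zero_iff.1 (by omega)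
    rw [h1, h2]
  | succ n ih =>
    intro p u v hn hag
    -- delete absorbed letters
    have del : ∀ u v : List ℕ, u.length + v.length ≤ n + 1 → Agree (p ++ u) (p ++ v) →
        (∃ b ∈ u, 2 ≤ p.count b) → ev f (p ++ u) = ev f (p ++ v) := by
      rintro u v hn hag ⟨b, hb, hc⟩
      obtain ⟨q1, q2, rfl⟩ := List.append_of_mem hb
      have hc' : 2 ≤ (p ++ q1).count b := by rw [List.count_append]; omega
      have d1 := agree_del q2 hc'
      have d2 := ev_del H f q2 hc'
      rw [List.append_assoc, List.append_assoc] at d1 d2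
      rw [d2]
      refine ih p (q1 ++ q2) v ?_ (d1.symm.trans hag)
      simp at hn ⊢; omega
    by_cases hu : ∃ b ∈ u, 2 ≤ p.count b
    · exact del u v hn hag hu
    by_cases hv : ∃ b ∈ v, 2 ≤ p.count b
    · exact (del v u (by omega) hag.symm hv).symm
    push Not at hu hv
    cases u with
    | nil =>
      cases v with
      | nil => rfl
      | cons b v =>
        have h1 := hag.1 b
        have h2 := hv b (by simp)
        simp only [List.count_append, List.count_cons_self, List.count_nil] at h1
        omega
    | cons a u =>
      have hpa := hu a (by simp)
      have hav : a ∈ v := by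
        have h1 := hag.1 a
        simp only [List.count_append, List.count_cons_self] at h1
        exact List.count_pos_iff.1 (by omega)
      obtain ⟨v1, v2, rfl, hv1⟩ := List.append_of_mem hav |>.elim fun _ _ =>
        List.eq_append_cons_of_mem hav
      have assoc : p ++ (v1 ++ a :: v2) = p ++ v1 ++ a :: v2 := by simp
      have fin : Agree (p ++ (v1 ++ a :: v2)) (p ++ a :: (v1 ++ v2)) ∧
          ev f (p ++ (v1 ++ a :: v2)) = ev f (p ++ a :: (v1 ++ v2)) := by
        by_cases hs : (p ++ a :: u).count a = 1
        · have hap : a ∉ p := by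
            intro hm
            have := List.count_pos_iff.2 hm
            simp only [List.count_append, List.count_cons_self] at hs
            omega
          have : v1 = [] := by
            cases v1 with
            | nil => rfl
            | cons b v1 =>
              exfalso
              have h1 := hag.2 a b hs
              have h2 := hv b (by simp)
              have hap' : a ∉ p ++ b :: v1 := by
                rw [List.mem_append]; tauto
              rw [preL_not_mem _ hap, preL_self, assoc, preL_not_mem _ hap', preL_self] at h1
              simp only [List.count_append, List.count_cons_self, List.count_nil] at h1
              omega
          subst this
          exact ⟨⟨fun _ => rfl, fun _ _ _ => rfl⟩, rfl⟩
        · rw [assoc]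
          refine ev_move H f v1 p ?_ ?_
          · rw [← assoc]
            have := hag.1 a
            omega
          · intro b hb hb1
            rw [← assoc] at hb1
            have h1 := hag.symm.2 b a hb1
            have hba : a ≠ b := by rintro rfl; exact hv1 hb
            have hbp : b ∉ p := by
              intro hm
              have := List.count_pos_iff.2 hm
              have := List.count_pos_iff.2 hb
              simp only [List.count_append] at hb1
              omega
            rw [preL_not_mem _ hbp, preL_not_mem _ hbp, preL_mem _ hb, preL_cons_ne hba] at h1
            have h0 : a ∉ preL b v1 := fun h => hv1 ((List.takeWhile_sublist _).subset h)
            simp only [List.count_append, List.count_cons_self,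
              List.count_eq_zero_of_not_mem h0] at h1
            omega
      rw [fin.2]
      have e1 : ∀ r : List ℕ, p ++ a :: r = (p ++ [a]) ++ r := by simp
      have hag' := hag.trans fin.1
      rw [e1 u, e1 (v1 ++ v2)] at hag'
      rw [e1 u, e1 (v1 ++ v2)]
      refine ih (p ++ [a]) u (v1 ++ v2) ?_ hag'
      simp at hn ⊢; omega

end Sem

section Low
variable {M : Type*} [Monoid M]

theorem pow_red (A : ∀ x y : M, x * y * x = x * y * x * x) (h : M) (n : ℕ) :
    h ^ (n + 2) = h ^ 2 := by
  induction n with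
  | zero => rfl
  | succ n ih =>
    have := A h 1
    simp only [mul_one] at this
    rw [show n + 1 + 2 = (n + 2) + 1 by omega, pow_succ, ih, pow_two, ← this]

theorem ev_single (h : M) (c : ℕ) (w : List ℕ) :
    ev (fun a => if a = c then h else 1) w = h ^ w.count c := by
  induction w with
  | nil => simp [ev]
  | cons a w ih =>
    rw [ev_cons, ih]
    by_cases e : a = c
    · subst e; simp [pow_succ']
    · simp [e]

theorem ev_pair (g h : M) {t c : ℕ} (hct : c ≠ t) {w : List ℕ} (hw : w.count t = 1) :
    ∃ l, ev (fun a => if a = t then g else if a = c then h else 1) w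
      = h ^ (preL t w).count c * g * h ^ l := by
  have none : ∀ r : List ℕ, t ∉ r →
      ev (fun a => if a = t then g else if a = c then h else 1) r = h ^ r.count c := by
    intro r hr
    rw [← ev_single h c r]
    unfold ev
    congr 1
    apply List.map_congr_left
    intro a ha
    have : a ≠ t := by rintro rfl; exact hr ha
    simp [this]
  obtain ⟨p, q, rfl⟩ := List.append_of_mem (List.count_pos_iff.1 (by omega : 0 < w.count t))
  simp only [List.count_append, List.count_cons_self] at hw
  have hp : t ∉ p := List.count_eq_zero.1 (by omega)
  have hq : t ∉ q := List.count_eq_zero.1 (by omega)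
  refine ⟨q.count c, ?_⟩
  rw [ev_append, ev_cons, none p hp, none q hq, preL_not_mem _ hp, preL_self]
  simp [mul_assoc]

theorem key_lt (A : ∀ x y : M, x * y * x = x * y * x * x) {g h : M} {i j k l : ℕ}
    (e : h ^ i * g * h ^ j = h ^ k * g * h ^ l) (hi : i < 2) (hik : i < k) :
    h * g * h = h * h * g * h := by
  have e1 := congrArg (fun w => h ^ (1 - i) * w * h ^ 2) e
  have r : ∀ m : ℕ, ∀ n : ℕ, ∀ s : ℕ, h ^ s * (h ^ m * g * h ^ n) * h ^ 2
      = h ^ (s + m) * g * h ^ 2 := by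
    intro m n s
    rw [pow_add h s m]
    have : h ^ n * h ^ 2 = h ^ 2 := by
      rw [← pow_add, pow_red A]
    simp only [mul_assoc]
    rw [this]
  simp only [r] at e1
  rw [show 1 - i + i = 1 by omega, pow_one,
    show 1 - i + k = (k - i - 1) + 2 by omega, pow_red A h (k - i - 1), pow_two, ← mul_assoc, ← mul_assoc] at e1
  have a1 := A h g
  have a2 := A h (h * g)
  simp only [← mul_assoc] at a2
  rw [a1, e1, ← a2]

theorem agree_of_sat (A : ∀ x y : M, x * y * x = x * y * x * x) {x y : M}
    (hQ : x * y * x ≠ x * x * y * x) {u v : List ℕ} (h : ∀ f : ℕ → M, ev f u = ev f v) :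
    Agree u v := by
  have noLt : ∀ i k : ℕ, (∀ z : M, z ^ i = z ^ k) → i < 2 → i < k → False := by
    intro i k e hi hik
    refine hQ (key_lt A (i := i) (j := 0) (k := k) (l := 0) ?_ hi hik)
    rw [e x]
  have one : ∀ c, min 2 (u.count c) = min 2 (v.count c) := by
    intro c
    have e : ∀ z : M, z ^ u.count c = z ^ v.count c := by
      intro z
      rw [← ev_single, ← ev_single]; exact h _
    by_contra hne
    rcases lt_or_ge (u.count c) (v.count c) with hlt | hge
    · exact noLt _ _ e (by omega) hlt
    · exact noLt _ _ (fun z => (e z).symm) (by omega) (by omega)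
  refine ⟨one, fun t c ht => ?_⟩
  have ht' : v.count t = 1 := by have := one t; omega
  by_cases hct : c = t
  · subst hct
    have : ∀ w : List ℕ, (preL c w).count c = 0 := by
      intro w
      apply List.count_eq_zero.2
      intro hm
      have := List.mem_takeWhile_imp hm
      simp at this
    rw [this, this]
  obtain ⟨j, hj⟩ := ev_pair y x hct ht
  obtain ⟨l, hl⟩ := ev_pair y x hct ht'
  have e := h (fun a => if a = t then y else if a = c then x else 1)
  rw [hj, hl] at e
  by_contra hne
  rcases lt_or_ge ((preL t u).count c) ((preL t v).count c) with hlt | hge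
  · exact hQ (key_lt A e (by omega) hlt)
  · exact hQ (key_lt A e.symm (by omega) (by omega))

end Low

theorem lift_eq_ev {M : Type*} [Monoid M] (f : ℕ → M) (w : Word) :
    FreeMonoid.lift f w = ev f (toList w) := by
  rw [FreeMonoid.lift_apply]; rfl

theorem msat_iff {M : Type*} [Monoid M] (e : Word × Word) :
    MSat M e ↔ ∀ f : ℕ → M, ev f (toList e.1) = ev f (toList e.2) := by
  constructor
  · intro h f
    rw [← lift_eq_ev, ← lift_eq_ev]; exact h _
  · intro h φ
    have := h (FreeMonoid.lift.symm φ)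
    rw [← lift_eq_ev, ← lift_eq_ev] at this
    simpa using this

theorem f0_of_sat {N : Type*} [Monoid N] (h : SatAll N F0set) : F0 N := by
  have h1 := (msat_iff _).1 (h (wd [0,1,0], wd [0,1,0,0]) (by simp [F0set]))
  have h2 := (msat_iff _).1 (h (wd [0,0,1,1], wd [1,1,0,0]) (by simp [F0set]))
  have h3 := (msat_iff _).1 (h (wd [0,1,2,0,1], wd [1,0,2,0,1]) (by simp [F0set]))
  have h4 := (msat_iff _).1 (h (wd [0,0,1], wd [0,0,1,0]) (by simp [F0set]))
  refine ⟨fun x y => ?_, fun x y => ?_, fun x y z => ?_, fun x y => ?_⟩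
  · simpa [wd, ev, mul_assoc] using h1 (fun n => if n = 0 then x else y)
  · simpa [wd, ev, mul_assoc] using h2 (fun n => if n = 0 then x else y)
  · simpa [wd, ev, mul_assoc] using h3 (fun n => if n = 0 then x else if n = 1 then y else z)
  · simpa [wd, ev, mul_assoc] using h4 (fun n => if n = 0 then x else y)

/-- If a variety `Mod S` satisfies `xyx ≈ xyx²` and `x²y² ≈ y²x²` and does not
contain the variety `F₀`, then it is contained in `Q`. -/
theorem contained_in_Q_of_not_contains_F (S : Set (Word × Word))
    (h1 : ∀ (M : Type uM) [Monoid M], SatAll M S → MSat M (wd [0,1,0], wd [0,1,0,0]))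
    (h2 : ∀ (M : Type uM) [Monoid M], SatAll M S → MSat M (wd [0,0,1,1], wd [1,1,0,0]))
    (hF : ∃ (M : Type uM) (inst : Monoid M), @SatAll M inst F0set ∧ ¬ @SatAll M inst S) :
    ∀ (M : Type uM) [Monoid M], SatAll M S → SatAll M Qset := by
  intro M _ hM
  obtain ⟨N, inst, hN, hNS⟩ := hF
  have H := f0_of_sat hN
  have A : ∀ x y : M, x * y * x = x * y * x * x := by
    intro x y
    have := (msat_iff _).1 (h1 M hM) (fun n => if n = 0 then x else y)
    simpa [wd, ev, mul_assoc] using this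
  have hq : MSat M (wd [0,1,0], wd [0,0,1,0]) := by
    rw [msat_iff]
    intro f
    by_contra hne
    have hne' : f 0 * f 1 * f 0 ≠ f 0 * f 0 * f 1 * f 0 := by
      simpa [wd, ev, mul_assoc] using hne
    apply hNS
    intro e he
    rw [msat_iff]
    intro g
    exact ev_main H g _ [] _ _ le_rfl (agree_of_sat A hne' ((msat_iff e).1 (hM e he)))
  intro e he
  simp only [Qset, Set.mem_insert_iff, Set.mem_singleton_iff] at he
  rcases he with rfl | rfl | rfl
  · exact h1 M hM
  · exact h2 M hM
  · exact hq
end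

section
/- A non-trivial identity u ≈ v (u ≠ v as words) holds in the join F₀ ∨ E — equivalently, holds both in every monoid satisfying the defining identities of F₀ and in every monoid satisfying the defining identities of E — if and only if all of the following hold: (i) simple(u) = simple(v) and mul(u) = mul(v); (ii) h₁(u,x) = h₁(v,x) for every letter x ∈ con(u); (iii) h₂(u,x) = h₂(v,x) for every letter x ∈ con(u); (iv) t(u,x) = t(v,x) for every letter x ∈ con(u). -/
open FreeMonoid

universe uM

namespace WP

/-- The prefix before the first occurrence of `t`. -/
def bef (t : ℕ) (w : List ℕ) : List ℕ := w.takeWhile (fun b => b ≠ t)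

theorem bef_app_mem {t : ℕ} {p : List ℕ} (q : List ℕ) (h : t ∈ p) :
    bef t (p ++ q) = bef t p := by
  induction p with
  | nil => simp at h
  | cons a p ih =>
    by_cases ha : a = t
    · subst ha; simp [bef]
    · have : t ∈ p := by simpa [Ne.symm ha] using h
      have := ih this
      simp only [bef] at this
      simp [bef, ha] at this ⊢
      exact this

theorem bef_app_not {t : ℕ} {p : List ℕ} (q : List ℕ) (h : t ∉ p) :
    bef t (p ++ q) = p ++ bef t q := by
  induction p with
  | nil => simp
  | cons a p ih =>
    have ha : a ≠ t := by rintro rfl; simp at h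
    have : t ∉ p := by intro h'; simp [h'] at h
    have := ih this
    simp only [bef] at this
    simp [bef, ha] at this ⊢
    exact this

theorem bef_self (t : ℕ) (q : List ℕ) : bef t (t :: q) = [] := by simp [bef]

theorem bef_cons_ne {t x : ℕ} (h : x ≠ t) (q : List ℕ) : bef t (x :: q) = x :: bef t q := by
  simp [bef, h]

theorem not_mem_bef (t : ℕ) (w : List ℕ) : t ∉ bef t w := by
  intro h
  have := List.mem_takeWhile_imp h
  simp at this

theorem bef_split {t : ℕ} {w : List ℕ} (h : t ∈ w) : ∃ q, w = bef t w ++ t :: q := by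
  induction w with
  | nil => simp at h
  | cons a p ih =>
    by_cases ha : a = t
    · subst ha; exact ⟨p, by simp [bef]⟩
    · have : t ∈ p := by simpa [Ne.symm ha] using h
      obtain ⟨q, hq⟩ := ih this
      refine ⟨q, ?_⟩
      rw [bef_cons_ne ha, List.cons_append, ← hq]

theorem bef_eq {t : ℕ} {p q : List ℕ} (h : t ∉ p) : bef t (p ++ t :: q) = p := by
  rw [bef_app_not _ h, bef_self, List.append_nil]

/-- first occurrence split -/
theorem split_first {t : ℕ} {w : List ℕ} (h : t ∈ w) : ∃ p q, w = p ++ t :: q ∧ t ∉ p := by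
  obtain ⟨q, hq⟩ := bef_split h
  exact ⟨_, q, hq, not_mem_bef t w⟩

theorem split_two {t : ℕ} {w : List ℕ} (h : 2 ≤ w.count t) :
    ∃ p q r, w = p ++ t :: (q ++ t :: r) := by
  have h1 : t ∈ w := List.count_pos_iff.1 (by omega)
  obtain ⟨p, q, rfl, hp⟩ := split_first h1
  have h2 : t ∈ q := by
    have := List.count_eq_zero_of_not_mem hp
    simp [this] at h
    exact h
  obtain ⟨a, b, rfl, _⟩ := split_first h2
  exact ⟨p, a, b, rfl⟩

def Inv (k : ℕ) (u v : List ℕ) : Prop :=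
  (∀ x, min 2 (u.count x) = min 2 (v.count x)) ∧
  ∀ t, u.count t = 1 → ∀ x, min k ((bef t u).count x) = min k ((bef t v).count x)

theorem Inv.symm {k : ℕ} {u v : List ℕ} (h : Inv k u v) : Inv k v u := by
  refine ⟨fun x => (h.1 x).symm, fun t ht x => (h.2 t ?_ x).symm⟩
  have := h.1 t
  omega

theorem Inv.trans {k : ℕ} {u v w : List ℕ} (h : Inv k u v) (h' : Inv k v w) : Inv k u w := by
  refine ⟨fun x => (h.1 x).trans (h'.1 x), fun t ht x => (h.2 t ht x).trans (h'.2 t ?_ x)⟩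
  have := h.1 t
  omega

theorem inv_del {p q : List ℕ} {x : ℕ} (h : 2 ≤ p.count x) : Inv 2 (p ++ x :: q) (p ++ q) := by
  refine ⟨fun y => ?_, fun t ht y => ?_⟩
  · by_cases hy : y = x
    · subst hy; simp; omega
    · simp [Ne.symm hy]
  · have hx : x ≠ t := by
      rintro rfl; simp at ht; omega
    by_cases hp : t ∈ p
    · rw [bef_app_mem _ hp, bef_app_mem _ hp]
    · rw [bef_app_not _ hp, bef_app_not _ hp, bef_cons_ne hx]
      by_cases hy : y = x
      · subst hy; simp; omega
      · simp [Ne.symm hy]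

theorem inv_swap {k : ℕ} {p q : List ℕ} {x y : ℕ} (hx : 2 ≤ (p ++ x :: y :: q).count x)
    (hy : 2 ≤ (p ++ x :: y :: q).count y) : Inv k (p ++ x :: y :: q) (p ++ y :: x :: q) := by
  have hperm : (p ++ x :: y :: q).Perm (p ++ y :: x :: q) :=
    List.Perm.append_left _ (List.Perm.swap _ _ _)
  refine ⟨fun z => by rw [hperm.count_eq], fun t ht z => ?_⟩
  have hx' : x ≠ t := by rintro rfl; omega
  have hy' : y ≠ t := by rintro rfl; omega
  by_cases hp : t ∈ p
  · rw [bef_app_mem _ hp, bef_app_mem _ hp]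
  · rw [bef_app_not _ hp, bef_app_not _ hp, bef_cons_ne hx', bef_cons_ne hy', bef_cons_ne hy',
      bef_cons_ne hx']
    have hperm : (p ++ x :: y :: bef t q).Perm (p ++ y :: x :: bef t q) :=
      List.Perm.append_left _ (List.Perm.swap _ _ _)
    rw [hperm.count_eq]

section core
variable {M : Type*} (f : List ℕ → M)

theorem del_list
    (Del : ∀ p x q, 2 ≤ p.count x → f (p ++ x :: q) = f (p ++ q))
    (c : List ℕ) : ∀ p q, (∀ y ∈ c, 2 ≤ p.count y) →
    f (p ++ (c ++ q)) = f (p ++ q) ∧ Inv 2 (p ++ (c ++ q)) (p ++ q) := by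
  induction c with
  | nil => intro p q _; exact ⟨rfl, fun _ => rfl, fun _ _ _ => rfl⟩
  | cons a c ih =>
    intro p q h
    have ha := h a (by simp)
    obtain ⟨h1, h2⟩ := ih p q (fun y hy => h y (by simp [hy]))
    exact ⟨(Del p a (c ++ q) ha).trans h1, (inv_del ha).trans h2⟩

theorem swap_list
    (Swap : ∀ p x y q, 2 ≤ (p ++ x :: y :: q).count x → 2 ≤ (p ++ x :: y :: q).count y →
      f (p ++ x :: y :: q) = f (p ++ y :: x :: q))
    (c : List ℕ) : ∀ p x q, 2 ≤ (p ++ (c ++ x :: q)).count x →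
    (∀ y ∈ c, 2 ≤ (p ++ (c ++ x :: q)).count y) →
    f (p ++ (c ++ x :: q)) = f (p ++ x :: (c ++ q)) ∧
      Inv 2 (p ++ (c ++ x :: q)) (p ++ x :: (c ++ q)) := by
  induction c with
  | nil => intro p x q _ _; exact ⟨rfl, fun _ => rfl, fun _ _ _ => rfl⟩
  | cons a c ih =>
    intro p x q hx h
    have e : p ++ (a :: c ++ x :: q) = (p ++ [a]) ++ (c ++ x :: q) := by simp
    rw [e] at hx h ⊢
    obtain ⟨h1, h2⟩ := ih (p ++ [a]) x q hx (fun y hy => h y (by simp [hy]))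
    have ha := h a (by simp)
    have e2 : (p ++ [a]) ++ x :: (c ++ q) = p ++ a :: x :: (c ++ q) := by simp
    have hp : ((p ++ [a]) ++ (c ++ x :: q)).Perm (p ++ a :: x :: (c ++ q)) := by
      rw [← e2]
      exact List.Perm.append_left _ List.perm_middle
    rw [hp.count_eq] at hx ha
    rw [e2] at h1 h2
    exact ⟨h1.trans (Swap _ _ _ _ ha hx), h2.trans (inv_swap ha hx)⟩

theorem core
    (Swap : ∀ p x y q, 2 ≤ (p ++ x :: y :: q).count x → 2 ≤ (p ++ x :: y :: q).count y →
      f (p ++ x :: y :: q) = f (p ++ y :: x :: q))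
    (Del : ∀ p x q, 2 ≤ p.count x → f (p ++ x :: q) = f (p ++ q))
    (a : List ℕ) : ∀ p c, Inv 2 (p ++ a) (p ++ c) → f (p ++ a) = f (p ++ c) := by
  induction a with
  | nil =>
    intro p c h
    have := del_list f Del c p [] (fun y hy => by
      have h1 := h.1 y
      have := List.count_pos_iff.2 hy
      simp at h1
      omega)
    simpa using this.1.symm
  | cons x a ih =>
    intro p c h
    have hcx := h.1 x
    have hx1 : 1 ≤ (p ++ x :: a).count x := by simp; omega
    have e : ∀ r, p ++ x :: r = (p ++ [x]) ++ r := fun r => by simp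
    by_cases hs : (p ++ x :: a).count x = 1
    · have hxp : x ∉ p := by
        intro hxp
        have := List.count_pos_iff.2 hxp
        simp at hs
        omega
      have hxc : x ∈ c := by
        have : x ∈ p ++ c := List.count_pos_iff.1 (by omega)
        simpa [hxp] using this
      obtain ⟨c0, c1, rfl, hc0⟩ := split_first hxc
      have hb := h.2 x hs
      rw [bef_eq hxp, ← List.append_assoc, bef_eq (by simp [hxp, hc0])] at hb
      obtain ⟨h1, h2⟩ := del_list f Del c0 p (x :: c1) (fun y hy => by
        have h1 := hb y
        have := List.count_pos_iff.2 hy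
        simp at h1
        omega)
      rw [h1]
      have h3 := h.trans h2
      rw [e a, e c1] at h3 ⊢
      exact ih _ _ h3
    · have hm : 2 ≤ (p ++ x :: a).count x := by omega
      by_cases hxp : 2 ≤ p.count x
      · rw [Del p x a hxp]
        exact ih _ _ ((inv_del hxp).symm.trans h)
      · have hxc : x ∈ c := by
          have : 2 ≤ (p ++ c).count x := by omega
          rw [List.count_append] at this
          exact List.count_pos_iff.1 (by omega)
        obtain ⟨c0, c1, rfl, hc0⟩ := split_first hxc
        obtain ⟨h1, h2⟩ := swap_list f Swap c0 p x c1 (by omega) (fun t ht => by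
          by_contra hlt
          have htv : (p ++ (c0 ++ x :: c1)).count t = 1 := by
            have := List.count_pos_iff.2 ht
            simp only [List.count_append] at hlt ⊢
            omega
          have htu : (p ++ x :: a).count t = 1 := by
            have := h.1 t
            omega
          have htp : t ∉ p := by
            intro htp
            have := List.count_pos_iff.2 htp
            have := List.count_pos_iff.2 ht
            simp only [List.count_append] at htv
            omega
          have hxt : x ≠ t := by rintro rfl; exact hc0 ht
          have := h.2 t htu x
          rw [bef_app_not _ htp, bef_app_not _ htp, bef_app_mem _ ht, bef_cons_ne hxt] at this
          have h0 : (bef t c0).count x = 0 := by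
            apply List.count_eq_zero_of_not_mem
            intro hh
            exact hc0 ((List.takeWhile_sublist _).subset hh)
          simp [h0] at this
          omega)
        rw [h1]
        have h3 := h.trans h2
        rw [e a, e (c0 ++ c1)] at h3 ⊢
        exact ih _ _ h3

end core

/-- doubling of letters outside `S` -/
def dbl (S : ℕ → Bool) (w : List ℕ) : List ℕ :=
  w.flatMap (fun x => if S x then [x] else [x, x])

theorem dbl_cons (S : ℕ → Bool) (x : ℕ) (w : List ℕ) :
    dbl S (x :: w) = (if S x then [x] else [x, x]) ++ dbl S w := by simp [dbl]

theorem count_dbl (S : ℕ → Bool) (w : List ℕ) (x : ℕ) :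
    (dbl S w).count x = if S x then w.count x else 2 * w.count x := by
  induction w with
  | nil => simp [dbl]
  | cons a w ih =>
    rw [dbl_cons, List.count_append, ih]
    by_cases hx : x = a
    · subst hx
      by_cases h : S x <;> simp [h] <;> omega
    · by_cases h : S x <;> by_cases h' : S a <;> simp [h, h', Ne.symm hx]

theorem bef_dbl (S : ℕ → Bool) (w : List ℕ) (t : ℕ) (ht : S t) :
    bef t (dbl S w) = dbl S (bef t w) := by
  induction w with
  | nil => simp [dbl, bef]
  | cons a w ih =>
    by_cases h : a = t
    · subst h
      simp [dbl_cons, ht, bef_self]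
      simp [dbl]
    · rw [bef_cons_ne h, dbl_cons, dbl_cons, ← ih]
      by_cases h' : S a <;> simp [h', bef_cons_ne h]

theorem inv_dbl {u v : List ℕ} (h : Inv 1 u v) (S : ℕ → Bool)
    (hS : ∀ x, S x ↔ u.count x = 1) : Inv 2 (dbl S u) (dbl S v) := by
  refine ⟨fun x => ?_, fun t ht x => ?_⟩
  · have := h.1 x
    rw [count_dbl, count_dbl]
    split_ifs <;> omega
  · rw [count_dbl] at ht
    have hSt : S t := by
      by_contra hc
      simp [hc] at ht
    simp [hSt] at ht
    have h2 := h.2 t ht x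
    rw [bef_dbl S u t hSt, bef_dbl S v t hSt, count_dbl, count_dbl]
    have hu : (bef t u).count x ≤ u.count x := (List.takeWhile_sublist _).count_le x
    have hv : (bef t v).count x ≤ v.count x := (List.takeWhile_sublist _).count_le x
    split_ifs with hSx
    · have := (hS x).1 hSx
      have := h.1 x
      omega
    · omega

theorem f_dbl {M : Type*} (f : List ℕ → M) (S : ℕ → Bool)
    (Dup : ∀ p x q, 2 ≤ (p ++ x :: q).count x → f (p ++ x :: q) = f (p ++ x :: x :: q))
    (a : List ℕ) : ∀ p, (∀ x ∈ a, ¬ S x → 2 ≤ (p ++ a).count x) →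
    f (p ++ a) = f (p ++ dbl S a) := by
  induction a with
  | nil => intro p _; simp [dbl]
  | cons x a ih =>
    intro p h
    rw [dbl_cons]
    by_cases hx : S x
    · have := ih (p ++ [x]) (fun y hy hS => by
        have := h y (by simp [hy]) hS
        simpa using this)
      simpa [hx] using this
    · rw [Dup p x a (h x (by simp) hx)]
      have := ih (p ++ [x, x]) (fun y hy hS => by
        have := h y (by simp [hy]) hS
        simp [List.count_cons] at this ⊢
        omega)
      simpa [hx] using this

theorem f_eq_E {M : Type*} (f : List ℕ → M)
    (Swap : ∀ p x y q, 2 ≤ (p ++ x :: y :: q).count x → 2 ≤ (p ++ x :: y :: q).count y →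
      f (p ++ x :: y :: q) = f (p ++ y :: x :: q))
    (Del : ∀ p x q, 2 ≤ p.count x → f (p ++ x :: q) = f (p ++ q))
    (Dup : ∀ p x q, 2 ≤ (p ++ x :: q).count x → f (p ++ x :: q) = f (p ++ x :: x :: q))
    {u v : List ℕ} (h : Inv 1 u v) : f u = f v := by
  let S : ℕ → Bool := fun x => decide (u.count x = 1)
  have hS : ∀ x, S x ↔ u.count x = 1 := fun x => by simp [S]
  have h1 := f_dbl f S Dup u [] (fun x hx hs => by
    rw [hS] at hs
    have := List.count_pos_iff.2 hx
    simp; omega)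
  have h2 := f_dbl f S Dup v [] (fun x hx hs => by
    rw [hS] at hs
    have := List.count_pos_iff.2 hx
    have := h.1 x
    simp; omega)
  have h3 := core f Swap Del (dbl S u) [] (dbl S v) (by simpa using inv_dbl h S hS)
  simp only [List.nil_append] at h1 h2 h3
  rw [h1, h2, h3]

section F0
variable {M : Type*} [Monoid M] (f : List ℕ → M) (hf : ∀ a b, f (a ++ b) = f a * f b)

theorem f_cons (hf : ∀ a b, f (a ++ b) = f a * f b) (x : ℕ) (a : List ℕ) :
    f (x :: a) = f [x] * f a := by rw [← hf]; rfl

theorem suff_F0 (hf : ∀ a b, f (a ++ b) = f a * f b)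
    (i1 : ∀ X Y : M, X * Y * X = X * Y * X * X)
    (i3 : ∀ X Y Z : M, X * Y * Z * X * Y = Y * X * Z * X * Y)
    (i4 : ∀ X Y : M, X * X * Y = X * X * Y * X) {u v : List ℕ} (h : Inv 2 u v) : f u = f v := by
  have Del : ∀ p x q, 2 ≤ p.count x → f (p ++ x :: q) = f (p ++ q) := by
    intro p x q h
    obtain ⟨a, b, c, rfl⟩ := split_two h
    simp only [hf, f_cons f hf x q, f_cons f hf x (b ++ x :: c), f_cons f hf x c]
    set X := f [x]
    have : X * f b * X * f c * X = X * f b * X * f c := by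
      calc X * f b * X * f c * X = X * f b * (X * X * f c * X) := by
            rw [i1 X (f b)]; simp only [mul_assoc]
        _ = X * f b * X * X * f c := by rw [← i4]; simp only [mul_assoc]
        _ = _ := by rw [← i1]
    calc _ = f a * (X * f b * X * f c * X) * f q := by simp only [mul_assoc]
      _ = _ := by rw [this]; simp only [mul_assoc]
  refine core f ?_ Del u [] v (by simpa using h)
  intro p x y q hx hy
  have key : ∀ w : List ℕ, 2 ≤ w.count x → 2 ≤ w.count y → f w = f w * f [x] * f [y] := by
    intro w h1 h2
    rw [← hf, Del w x [] h1, List.append_nil, ← hf, Del w y [] h2, List.append_nil]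
  have hp : (p ++ x :: y :: q).Perm (p ++ y :: x :: q) :=
    List.Perm.append_left _ (List.Perm.swap _ _ _)
  rw [key _ hx hy, key (p ++ y :: x :: q) (by rw [← hp.count_eq]; exact hx)
    (by rw [← hp.count_eq]; exact hy)]
  have := i3 (f [x]) (f [y]) (f q)
  simp only [hf, f_cons f hf x (y :: q), f_cons f hf y (x :: q), f_cons f hf x q,
    f_cons f hf y q]
  simp only [mul_assoc] at this ⊢
  rw [this]

theorem suff_E (hf : ∀ a b, f (a ++ b) = f a * f b)
    (i1 : ∀ X Y : M, X * X * Y * Y = Y * Y * X * X)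
    (i2 : ∀ X : M, X * X = X * X * X)
    (i3 : ∀ X Y : M, X * X * Y = X * Y * X) {u v : List ℕ} (h : Inv 1 u v) : f u = f v := by
  have Del : ∀ p x q, 2 ≤ p.count x → f (p ++ x :: q) = f (p ++ q) := by
    intro p x q h
    obtain ⟨a, b, c, rfl⟩ := split_two h
    simp only [hf, f_cons f hf x q, f_cons f hf x (b ++ x :: c), f_cons f hf x c]
    set X := f [x]
    have : X * f b * X * f c * X = X * f b * X * f c := by
      calc X * f b * X * f c * X = X * (X * (f b * f c) * X) := by
            rw [← i3 X (f b)]; simp only [mul_assoc]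
        _ = (X * X * X) * f b * f c := by rw [← i3]; simp only [mul_assoc]
        _ = _ := by rw [← i2, ← i3]
    calc _ = f a * (X * f b * X * f c * X) * f q := by simp only [mul_assoc]
      _ = _ := by rw [this]; simp only [mul_assoc]
  have Dup : ∀ p x q, 2 ≤ (p ++ x :: q).count x → f (p ++ x :: q) = f (p ++ x :: x :: q) := by
    intro p x q h
    by_cases hp : x ∈ p
    · have := Del (p ++ [x]) x q (by
        have := List.count_pos_iff.2 hp
        simp; omega)
      simpa using this.symm
    · have hq : x ∈ q := by
        have := List.count_eq_zero_of_not_mem hp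
        apply List.count_pos_iff.1
        simp [this] at h
        simpa using h
      obtain ⟨a, b, rfl, _⟩ := split_first hq
      simp only [hf, f_cons f hf x (x :: (a ++ x :: b)), f_cons f hf x (a ++ x :: b),
        f_cons f hf x b]
      set X := f [x]
      have : X * f a * X = X * X * f a * X := by
        calc X * f a * X = X * X * X * f a := by rw [← i3, ← i2]
          _ = X * (X * X * f a) := by simp only [mul_assoc]
          _ = _ := by conv_lhs => rw [i3 X (f a)]
                      simp only [mul_assoc]
      calc _ = f p * (X * f a * X) * f b := by simp only [mul_assoc]
        _ = _ := by rw [this]; simp only [mul_assoc]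
  have swap1 : ∀ p x y q, y ∈ p → f (p ++ x :: y :: q) = f (p ++ y :: x :: q) := by
    intro p x y q hy
    obtain ⟨a, b, rfl, _⟩ := split_first hy
    simp only [hf, f_cons f hf x (y :: q), f_cons f hf y (x :: q), f_cons f hf x q,
      f_cons f hf y q, f_cons f hf y b]
    have h1 := i3 (f [y]) (f b * f [x])
    have h2 := i3 (f [y]) (f b)
    calc _ = f a * (f [y] * (f b * f [x]) * f [y]) * f q := by simp only [mul_assoc]
      _ = f a * (f [y] * f [y] * f b) * f [x] * f q := by rw [← h1]; simp only [mul_assoc]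
      _ = _ := by rw [h2]; simp only [mul_assoc]
  refine f_eq_E f ?_ Del Dup h
  intro p x y q hx hy
  by_cases hyp : y ∈ p
  · exact swap1 p x y q hyp
  by_cases hxp : x ∈ p
  · exact (swap1 p y x q hxp).symm
  have hper : (p ++ x :: y :: q).Perm (p ++ y :: x :: q) :=
    List.Perm.append_left _ (List.Perm.swap _ _ _)
  have h1 : f (p ++ x :: y :: q) = f (p ++ x :: x :: y :: y :: q) := by
    rw [Dup p x _ hx]
    have := Dup (p ++ [x, x]) y q (by
      simp [List.count_cons] at hy ⊢; omega)
    simpa using this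
  have h2 : f (p ++ y :: x :: q) = f (p ++ y :: y :: x :: x :: q) := by
    rw [hper.count_eq] at hx hy
    rw [Dup p y _ hy]
    have := Dup (p ++ [y, y]) x q (by
      simp [List.count_cons] at hx ⊢; omega)
    simpa using this
  rw [h1, h2]
  have := i1 (f [x]) (f [y])
  simp only [hf, f_cons f hf x (x :: y :: y :: q), f_cons f hf x (y :: y :: q),
    f_cons f hf y (y :: q), f_cons f hf y (y :: x :: x :: q), f_cons f hf y (x :: x :: q),
    f_cons f hf x (x :: q), f_cons f hf x q, f_cons f hf y q]
  calc _ = f p * (f [x] * f [x] * f [y] * f [y]) * f q := by simp only [mul_assoc]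
    _ = _ := by rw [this]; simp only [mul_assoc]
end F0

/-! ### Separating monoids -/

def capN (n : ℕ) : Fin 3 := ⟨min 2 n, by omega⟩

theorem capN_add (m n : ℕ) : capN ((capN m).val + (capN n).val) = capN (m + n) := by
  simp only [capN, Fin.mk.injEq]; omega

theorem capN_inj {m n : ℕ} (h : capN m = capN n) : min 2 m = min 2 n := by
  simpa [capN] using h

abbrev TF : Type := Option (Option (Fin 3))

structure MF where
  a : Fin 3
  s : TF

def smulF (a : Fin 3) : TF → TF → TF
  | none, none => none
  | none, some none => some none
  | none, some (some c) => some (some (capN (a.val + c.val)))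
  | some c, none => some c
  | some _, some _ => some none

def mulF (m n : MF) : MF := ⟨capN (m.a.val + n.a.val), smulF m.a m.s n.s⟩

instance : Monoid MF where
  mul := mulF
  one := ⟨0, none⟩
  mul_assoc := by
    change ∀ a b c, mulF (mulF a b) c = mulF a (mulF b c)
    rintro ⟨a, s⟩ ⟨b, s'⟩ ⟨c, s''⟩
    simp only [mulF, MF.mk.injEq]
    constructor
    · simp only [capN, Fin.mk.injEq]; omega
    · rcases s with _ | _ | s <;> rcases s' with _ | _ | s' <;> rcases s'' with _ | _ | s'' <;>
        simp [smulF, capN] <;> omega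
  one_mul := by
    change ∀ a, mulF ⟨0, none⟩ a = a
    rintro ⟨a, s⟩
    simp only [mulF, MF.mk.injEq]
    refine ⟨Fin.ext ?_, ?_⟩
    · simp [capN]; omega
    · rcases s with _ | _ | s <;> simp [smulF, capN, Fin.ext_iff]
      omega
  mul_one := by
    change ∀ a, mulF a ⟨0, none⟩ = a
    rintro ⟨a, s⟩
    simp only [mulF, MF.mk.injEq]
    refine ⟨Fin.ext ?_, ?_⟩
    · simp [capN]; omega
    · rcases s with _ | _ | s <;> simp [smulF]

theorem mulF_def (m n : MF) : m * n = ⟨capN (m.a.val + n.a.val), smulF m.a m.s n.s⟩ := rfl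
theorem oneF_def : (1 : MF) = ⟨0, none⟩ := rfl

theorem MF_i1 : ∀ X Y : MF, X * Y * X = X * Y * X * X := by
  rintro ⟨a, sa⟩ ⟨b, sb⟩
  simp only [mulF_def, MF.mk.injEq]
  constructor
  · simp only [capN, Fin.mk.injEq]; omega
  · rcases sa with _ | _ | sa <;>
      rcases sb with _ | _ | sb <;>
      simp [smulF, capN]
    all_goals omega
theorem MF_i2 : ∀ X Y : MF, X * X * Y * Y = Y * Y * X * X := by
  rintro ⟨a, sa⟩ ⟨b, sb⟩
  simp only [mulF_def, MF.mk.injEq]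
  constructor
  · simp only [capN, Fin.mk.injEq]; omega
  · rcases sa with _ | _ | sa <;>
      rcases sb with _ | _ | sb <;>
      simp [smulF, capN]
    all_goals omega
theorem MF_i4 : ∀ X Y : MF, X * X * Y = X * X * Y * X := by
  rintro ⟨a, sa⟩ ⟨b, sb⟩
  simp only [mulF_def, MF.mk.injEq]
  constructor
  · simp only [capN, Fin.mk.injEq]; omega
  · rcases sa with _ | _ | sa <;>
      rcases sb with _ | _ | sb <;>
      simp [smulF, capN]
    all_goals omega
theorem MF_i3 : ∀ X Y Z : MF, X * Y * Z * X * Y = Y * X * Z * X * Y := by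
  rintro ⟨a, sa⟩ ⟨b, sb⟩ ⟨c, sc⟩
  simp only [mulF_def, MF.mk.injEq]
  constructor
  · simp only [capN, Fin.mk.injEq]; omega
  · rcases sa with _ | _ | sa <;>
      rcases sb with _ | _ | sb <;>
      rcases sc with _ | _ | sc <;>
      simp [smulF, capN]
    all_goals omega

structure ME where
  a : Bool
  s : Option (Option Bool)

def smulE (a' : Bool) : Option (Option Bool) → Option (Option Bool) → Option (Option Bool)
  | none, s => s
  | some none, none => some none
  | some (some c), none => some (some (c || a'))
  | some _, some _ => some none

def mulE (m n : ME) : ME := ⟨m.a || n.a, smulE n.a m.s n.s⟩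

instance : Monoid ME where
  mul := mulE
  one := ⟨false, none⟩
  mul_assoc := by
    change ∀ a b c, mulE (mulE a b) c = mulE a (mulE b c)
    rintro ⟨a, s⟩ ⟨b, s'⟩ ⟨c, s''⟩
    rcases s with _ | _ | s <;> rcases s' with _ | _ | s' <;> rcases s'' with _ | _ | s'' <;>
      simp [mulE, smulE, Bool.or_assoc]
  one_mul := by
    change ∀ a, mulE ⟨false, none⟩ a = a
    rintro ⟨a, s⟩
    rcases s with _ | _ | s <;> simp [mulE, smulE]
  mul_one := by
    change ∀ a, mulE a ⟨false, none⟩ = a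
    rintro ⟨a, s⟩
    rcases s with _ | _ | s <;> simp [mulE, smulE]

theorem mulE_def (m n : ME) : m * n = ⟨m.a || n.a, smulE n.a m.s n.s⟩ := rfl
theorem oneE_def : (1 : ME) = ⟨false, none⟩ := rfl

theorem ME_i1 : ∀ X Y : ME, X * X * Y * Y = Y * Y * X * X := by
  rintro ⟨a, s⟩ ⟨b, s'⟩
  rcases s with _ | _ | s <;> rcases s' with _ | _ | s' <;> cases a <;> cases b <;>
    simp [mulE_def, smulE]
theorem ME_i2 : ∀ X : ME, X * X = X * X * X := by
  rintro ⟨a, s⟩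
  rcases s with _ | _ | s <;> cases a <;> simp [mulE_def, smulE]
theorem ME_i3 : ∀ X Y : ME, Y * X * X = X * Y * X := by
  rintro ⟨a, s⟩ ⟨b, s'⟩
  rcases s with _ | _ | s <;> rcases s' with _ | _ | s' <;> cases a <;> cases b <;>
    simp [mulE_def, smulE]

theorem wd_cons (M : Type*) [Monoid M] (φ : Word →* M) (a : ℕ) (l : List ℕ) :
    φ (wd (a :: l)) = φ (of a) * φ (wd l) := by
  rw [← map_mul]; rfl

theorem wd_nil (M : Type*) [Monoid M] (φ : Word →* M) : φ (wd []) = 1 := map_one φ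

theorem satF0_iff (M : Type*) [Monoid M] : SatAll M F0set ↔
    ((∀ X Y : M, X * Y * X = X * Y * X * X) ∧ (∀ X Y : M, X * X * Y * Y = Y * Y * X * X) ∧
      (∀ X Y Z : M, X * Y * Z * X * Y = Y * X * Z * X * Y) ∧
      (∀ X Y : M, X * X * Y = X * X * Y * X)) := by
  have key : SatAll M F0set ↔ ∀ φ : Word →* M,
      ((φ (of 0) * φ (of 1) * φ (of 0) = φ (of 0) * φ (of 1) * φ (of 0) * φ (of 0)) ∧
      (φ (of 0) * φ (of 0) * φ (of 1) * φ (of 1) = φ (of 1) * φ (of 1) * φ (of 0) * φ (of 0)) ∧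
      (φ (of 0) * φ (of 1) * φ (of 2) * φ (of 0) * φ (of 1) =
        φ (of 1) * φ (of 0) * φ (of 2) * φ (of 0) * φ (of 1)) ∧
      (φ (of 0) * φ (of 0) * φ (of 1) = φ (of 0) * φ (of 0) * φ (of 1) * φ (of 0))) := by
    simp only [SatAll, F0set, Set.mem_insert_iff, Set.mem_singleton_iff, forall_eq_or_imp,
      forall_eq, MSat, wd_cons, wd_nil, mul_one, mul_assoc, forall_and]
  rw [key]
  constructor
  · intro h
    refine ⟨fun X Y => ?_, fun X Y => ?_, fun X Y Z => ?_, fun X Y => ?_⟩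
    · simpa using (h (FreeMonoid.lift (fun n => if n = 0 then X else Y))).1
    · simpa using (h (FreeMonoid.lift (fun n => if n = 0 then X else Y))).2.1
    · simpa using (h (FreeMonoid.lift (fun n => if n = 0 then X else if n = 1 then Y else Z))).2.2.1
    · simpa using (h (FreeMonoid.lift (fun n => if n = 0 then X else Y))).2.2.2
  · rintro ⟨h1, h2, h3, h4⟩ φ
    exact ⟨h1 _ _, h2 _ _, h3 _ _ _, h4 _ _⟩

theorem satE_iff (M : Type*) [Monoid M] : SatAll M Eset ↔
    ((∀ X Y : M, X * X * Y * Y = Y * Y * X * X) ∧ (∀ X : M, X * X = X * X * X) ∧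
      (∀ X Y : M, Y * X * X = X * Y * X)) := by
  have key : SatAll M Eset ↔ ∀ φ : Word →* M,
      ((φ (of 0) * φ (of 0) * φ (of 1) * φ (of 1) = φ (of 1) * φ (of 1) * φ (of 0) * φ (of 0)) ∧
      (φ (of 0) * φ (of 0) = φ (of 0) * φ (of 0) * φ (of 0)) ∧
      (φ (of 1) * φ (of 0) * φ (of 0) = φ (of 0) * φ (of 1) * φ (of 0))) := by
    simp only [SatAll, Eset, Set.mem_insert_iff, Set.mem_singleton_iff, forall_eq_or_imp,
      forall_eq, MSat, wd_cons, wd_nil, mul_one, mul_assoc, forall_and]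
  rw [key]
  constructor
  · intro h
    refine ⟨fun X Y => ?_, fun X => ?_, fun X Y => ?_⟩
    · simpa using (h (FreeMonoid.lift (fun n => if n = 0 then X else Y))).1
    · simpa using (h (FreeMonoid.lift (fun _ => X))).2.1
    · simpa using (h (FreeMonoid.lift (fun n => if n = 0 then X else Y))).2.2
  · rintro ⟨h1, h2, h3⟩ φ
    exact ⟨h1 _ _, h2 _, h3 _ _⟩

theorem MSat_ulift (N : Type) [Monoid N] (e : Word × Word) :
    MSat (ULift.{uM} N) e ↔ MSat N e := by
  constructor
  · intro h φ
    have := h ((MulEquiv.ulift : ULift.{uM} N ≃* N).symm.toMonoidHom.comp φ)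
    simpa using this
  · intro h φ
    have := h ((MulEquiv.ulift : ULift.{uM} N ≃* N).toMonoidHom.comp φ)
    simpa using this

theorem transfer (S : Set (Word × Word)) (e : Word × Word)
    (h : ∀ (M : Type uM) [Monoid M], SatAll M S → MSat M e) (N : Type) [Monoid N]
    (hN : SatAll N S) : MSat N e :=
  (MSat_ulift.{uM} N e).1 (h _ (fun e he => (MSat_ulift.{uM} N e).2 (hN e he)))

def gF (x t : ℕ) (y : ℕ) : MF :=
  if y = x then ⟨1, none⟩ else if y = t then ⟨0, some (some 0)⟩ else 1

def evF (x t : ℕ) (w : List ℕ) : MF := (w.map (gF x t)).prod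

theorem evF_append (x t : ℕ) (p q : List ℕ) : evF x t (p ++ q) = evF x t p * evF x t q := by
  simp [evF]

theorem evF_fst (x t : ℕ) (w : List ℕ) : (evF x t w).a = capN (w.count x) := by
  induction w with
  | nil => rfl
  | cons b w ih =>
    have : evF x t (b :: w) = gF x t b * evF x t w := by simp [evF]
    rw [this, mulF_def]
    simp only [ih]
    have hb : (gF x t b).a = capN (if b = x then 1 else 0) := by
      unfold gF; split_ifs <;> rfl
    rw [hb, capN_add, List.count_cons, add_comm]
    simp

theorem evF_snd (x t : ℕ) (w : List ℕ) (h : t ∉ w) : (evF x t w).s = none := by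
  induction w with
  | nil => rfl
  | cons b w ih =>
    have : evF x t (b :: w) = gF x t b * evF x t w := by simp [evF]
    rw [this, mulF_def]
    have h1 : t ∉ w := fun h' => h (by simp [h'])
    have h2 : b ≠ t := by rintro rfl; simp at h
    simp only [ih h1]
    have hb : (gF x t b).s = none := by
      unfold gF; split_ifs <;> rfl
    rw [hb]; rfl

theorem evF_split (x t : ℕ) (p q : List ℕ) (hx : x ≠ t) (hp : t ∉ p) (hq : t ∉ q) :
    (evF x t (p ++ t :: q)).s = some (some (capN (p.count x))) := by
  have : evF x t (t :: q) = gF x t t * evF x t q := by simp [evF]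
  rw [evF_append, this, mulF_def, mulF_def]
  have hg : gF x t t = ⟨0, some (some 0)⟩ := by simp [gF, Ne.symm hx]
  simp only [evF_snd x t _ hp, evF_snd x t _ hq, evF_fst, hg, smulF]
  simp [capN]

def gE (x t : ℕ) (y : ℕ) : ME :=
  if y = x then ⟨true, none⟩ else if y = t then ⟨false, some (some false)⟩ else 1

def evE (x t : ℕ) (w : List ℕ) : ME := (w.map (gE x t)).prod

theorem evE_append (x t : ℕ) (p q : List ℕ) : evE x t (p ++ q) = evE x t p * evE x t q := by
  simp [evE]

theorem evE_no (x t : ℕ) (w : List ℕ) (h : t ∉ w) : evE x t w = ⟨decide (x ∈ w), none⟩ := by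
  induction w with
  | nil => simp [evE, oneE_def]
  | cons b w ih =>
    have : evE x t (b :: w) = gE x t b * evE x t w := by simp [evE]
    have h1 : t ∉ w := fun h' => h (by simp [h'])
    have h2 : b ≠ t := by rintro rfl; simp at h
    rw [this, ih h1]
    by_cases hb : b = x
    · simp [gE, hb, mulE_def, smulE]
    · simp [gE, hb, h2, Ne.symm hb]

theorem evE_split (x t : ℕ) (p q : List ℕ) (hx : x ≠ t) (hp : t ∉ p) (hq : t ∉ q) :
    (evE x t (p ++ t :: q)).s = some (some (decide (x ∈ q))) := by
  have : evE x t (t :: q) = gE x t t * evE x t q := by simp [evE]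
  rw [evE_append, this, evE_no x t p hp, evE_no x t q hq]
  simp [gE, Ne.symm hx, mulE_def, smulE]

theorem lift_eq {M : Type*} [Monoid M] (g : ℕ → M) (w : Word) :
    FreeMonoid.lift g w = ((toList w).map g).prod := by
  rw [FreeMonoid.lift_apply]

theorem simple_split {t : ℕ} {w : List ℕ} (h : w.count t = 1) :
    ∃ q, w = bef t w ++ t :: q ∧ t ∉ q := by
  obtain ⟨q, hq⟩ := bef_split (List.count_pos_iff.1 (by omega : 0 < w.count t))
  refine ⟨q, hq, fun hh => ?_⟩
  have := List.count_pos_iff.2 hh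
  rw [hq] at h
  simp at h
  omega

theorem bef_reverse {t : ℕ} {w q : List ℕ} (h : w = bef t w ++ t :: q) (hq : t ∉ q) :
    bef t w.reverse = q.reverse := by
  rw [h]
  have : (bef t w ++ t :: q).reverse = q.reverse ++ t :: (bef t w).reverse := by simp
  rw [this, bef_eq (by simpa using hq)]

theorem nec_F (u v : Word) (h : ∀ (M : Type uM) [Monoid M], SatAll M F0set → MSat M (u, v)) :
    Inv 2 (toList u) (toList v) := by
  have h1 := transfer F0set (u, v) h MF ((satF0_iff MF).2 ⟨MF_i1, MF_i2, MF_i3, MF_i4⟩)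
  have h2 : ∀ x t, evF x t (toList u) = evF x t (toList v) := by
    intro x t
    have := h1 (FreeMonoid.lift (gF x t))
    rwa [lift_eq, lift_eq] at this
  have hc : ∀ x, min 2 ((toList u).count x) = min 2 ((toList v).count x) := by
    intro x
    apply capN_inj
    rw [← evF_fst x x, ← evF_fst x x, h2]
  refine ⟨hc, fun t ht x => ?_⟩
  by_cases hx : x = t
  · subst hx
    rw [List.count_eq_zero_of_not_mem (not_mem_bef _ _),
      List.count_eq_zero_of_not_mem (not_mem_bef _ _)]
  have ht' : (toList v).count t = 1 := by have := hc t; omega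
  obtain ⟨q, e, hq⟩ := simple_split ht
  obtain ⟨q', e', hq'⟩ := simple_split ht'
  have h3 := congrArg MF.s (h2 x t)
  rw [e, e', evF_split x t _ _ hx (not_mem_bef _ _) hq,
    evF_split x t _ _ hx (not_mem_bef _ _) hq'] at h3
  exact capN_inj (by simpa using h3)

theorem nec_E (u v : Word) (hc : ∀ x, min 2 ((toList u).count x) = min 2 ((toList v).count x))
    (h : ∀ (M : Type uM) [Monoid M], SatAll M Eset → MSat M (u, v)) :
    Inv 1 (toList u).reverse (toList v).reverse := by
  have h1 := transfer Eset (u, v) h ME ((satE_iff ME).2 ⟨ME_i1, ME_i2, ME_i3⟩)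
  have h2 : ∀ x t, evE x t (toList u) = evE x t (toList v) := by
    intro x t
    have := h1 (FreeMonoid.lift (gE x t))
    rwa [lift_eq, lift_eq] at this
  refine ⟨by simpa using hc, fun t ht x => ?_⟩
  rw [List.count_reverse] at ht
  by_cases hx : x = t
  · subst hx
    rw [List.count_eq_zero_of_not_mem (not_mem_bef _ _),
      List.count_eq_zero_of_not_mem (not_mem_bef _ _)]
  have ht' : (toList v).count t = 1 := by have := hc t; omega
  obtain ⟨q, e, hq⟩ := simple_split ht
  obtain ⟨q', e', hq'⟩ := simple_split ht'
  have h3 := congrArg ME.s (h2 x t)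
  rw [bef_reverse e hq, bef_reverse e' hq', List.count_reverse, List.count_reverse]
  rw [e, e', evE_split x t _ _ hx (not_mem_bef _ _) hq,
    evE_split x t _ _ hx (not_mem_bef _ _) hq'] at h3
  have h4 : x ∈ q ↔ x ∈ q' := by simpa using h3
  rw [← List.count_pos_iff, ← List.count_pos_iff] at h4
  omega

theorem suff_F0' (u v : Word) (h : Inv 2 (toList u) (toList v)) (M : Type*) [Monoid M]
    (hM : SatAll M F0set) : MSat M (u, v) := by
  intro φ
  obtain ⟨i1, i2, i3, i4⟩ := (satF0_iff M).1 hM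
  exact suff_F0 (fun w => φ (ofList w)) (fun a b => by rw [ofList_append, map_mul]) i1 i3 i4 h

theorem suff_E' (u v : Word) (h : Inv 1 (toList u).reverse (toList v).reverse) (M : Type*)
    [Monoid M] (hM : SatAll M Eset) : MSat M (u, v) := by
  intro φ
  obtain ⟨i1, i2, i3⟩ := (satE_iff M).1 hM
  have := suff_E (M := Mᵐᵒᵖ) (fun w => MulOpposite.op (φ (ofList w.reverse)))
    (fun a b => by rw [List.reverse_append, ofList_append, map_mul, MulOpposite.op_mul])
    (fun X Y => by
      apply MulOpposite.unop_injective
      have := i1 Y.unop X.unop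
      simpa [mul_assoc] using this)
    (fun X => by
      apply MulOpposite.unop_injective
      have := i2 X.unop
      simpa [mul_assoc] using this)
    (fun X Y => by
      apply MulOpposite.unop_injective
      have := i3 X.unop Y.unop
      simpa [mul_assoc] using this) h
  simpa using this

/-! ### The divider functions -/

theorem nthOccIdx_cons (b : ℕ) (w : List ℕ) (a k : ℕ) :
    nthOccIdx (b :: w) a (k + 1) =
      if b = a then (if k = 0 then 0 else nthOccIdx w a k + 1) else nthOccIdx w a (k + 1) + 1 := by
  have key : ∀ (l : List ℕ) (j n : ℕ), (l.map Nat.succ).getD j (n + 1) = l.getD j n + 1 := by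
    intro l j n
    induction l generalizing j with
    | nil => simp
    | cons c l ih => cases j <;> simp
  unfold nthOccIdx
  rw [List.length_cons, List.range_succ_eq_map, List.filter_cons, List.filter_map]
  have e : ((fun j => (b :: w).getD j (a + 1) == a) ∘ Nat.succ) =
      fun j => w.getD j (a + 1) == a := by
    funext j; simp
  rw [e]
  by_cases hb : b = a
  · cases k with
    | zero => simp [hb]
    | succ k => simp [hb, ← key]
  · simp [hb, ← key]

theorem mem_pre (w : List ℕ) (a t : ℕ) : ∀ k, t ∈ w →
    (t ∈ w.take (nthOccIdx w a (k + 1)) ↔ (bef t w ++ [t]).count a < k + 1) := by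
  induction w with
  | nil => intro k h; simp at h
  | cons b w ih =>
    intro k ht
    rw [nthOccIdx_cons]
    by_cases hbt : b = t
    · subst hbt
      rw [bef_self]
      by_cases hb : b = a
      · subst hb
        by_cases hk : k = 0 <;> simp [hk]
        omega
      · simp [hb]
    · have htw : t ∈ w := by simpa [Ne.symm hbt] using ht
      rw [bef_cons_ne hbt]
      by_cases hb : b = a
      · subst hb
        cases k with
        | zero => simp
        | succ k =>
          have := ih k htw
          simp [Ne.symm hbt] at this ⊢
          rw [this]
      · have := ih k htw
        simp [hb, Ne.symm hbt] at this ⊢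
        rw [this]

theorem hdiv_spec (w : List ℕ) (a k : ℕ) :
    (hdiv w a (k + 1) = none ∧ ∀ t, w.count t = 1 → ¬ (bef t w ++ [t]).count a < k + 1) ∨
    (∃ d, hdiv w a (k + 1) = some d ∧ w.count d = 1 ∧
      ∀ t, w.count t = 1 → ((bef t w ++ [t]).count a < k + 1 ↔ t = d ∨ t ∈ bef d w)) := by
  have hm : ∀ t, w.count t = 1 →
      (t ∈ w.take (nthOccIdx w a (k + 1)) ↔ (bef t w ++ [t]).count a < k + 1) :=
    fun t ht => mem_pre w a t k (List.count_pos_iff.1 (by omega))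
  unfold hdiv
  set n := nthOccIdx w a (k + 1)
  rcases List.eq_nil_or_concat ((w.take n).filter fun b => w.count b == 1) with h | ⟨l, d, h⟩
  · left
    rw [h]
    refine ⟨rfl, fun t ht => ?_⟩
    rw [← hm t ht]
    intro hh
    have : t ∈ (w.take n).filter fun b => w.count b == 1 := by simp [hh, ht]
    rw [h] at this
    simp at this
  · right
    rw [h]
    obtain ⟨l1, l2, e1, e2, e3⟩ := List.filter_eq_append_iff.1 (by simpa using h)
    obtain ⟨m1, m2, e4, e5, e6, e7⟩ := List.filter_eq_cons_iff.1 e3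
    have hd : w.count d = 1 := by simpa using e6
    refine ⟨d, by simp, hd, fun t ht => ?_⟩
    rw [← hm t ht]
    have hw : w = (l1 ++ m1) ++ d :: (m2 ++ w.drop n) := by
      conv_lhs => rw [← List.take_append_drop n w, e1, e4]
      simp
    have hdn : d ∉ l1 ++ m1 := by
      intro hh
      have := List.count_pos_iff.2 hh
      rw [hw] at hd
      rw [List.count_append, List.count_cons_self] at hd
      omega
    have hb : bef d w = l1 ++ m1 := by
      rw [hw]; exact bef_eq hdn
    have h7 : t ∉ m2 := by
      intro hh
      have : t ∈ m2.filter fun b => w.count b == 1 := by simp [hh, ht]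
      rw [e7] at this
      simp at this
    rw [hb, e1, e4]
    simp only [List.mem_append, List.mem_cons]
    tauto

theorem bef_anti {w : List ℕ} {d e : ℕ} (he : e ∈ w) (h : d ∈ bef e w) : e ∉ bef d w := by
  obtain ⟨q, hq⟩ := bef_split he
  have : bef d w = bef d (bef e w) := by
    conv_lhs => rw [hq]
    exact bef_app_mem _ h
  rw [this]
  intro hh
  exact not_mem_bef e w ((List.takeWhile_sublist _).subset hh)

theorem bef_tot {w : List ℕ} {d e : ℕ} (he : e ∈ w) (hne : e ≠ d) (h : d ∉ bef e w) :
    e ∈ bef d w := by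
  obtain ⟨q, hq⟩ := bef_split he
  rw [hq, bef_app_not _ h, bef_cons_ne hne]
  simp

theorem K_one {w : List ℕ} {d t : ℕ} (hd : w.count d = 1) (ht : w.count t = 1) :
    (bef t w ++ [t]).count d < 0 + 1 ↔ t ∈ bef d w := by
  have hd' : d ∈ w := List.count_pos_iff.1 (by omega)
  have ht' : t ∈ w := List.count_pos_iff.1 (by omega)
  rw [Nat.lt_iff_add_one_le, Nat.add_le_add_iff_right, Nat.le_zero, List.count_eq_zero]
  constructor
  · intro h
    simp only [List.mem_append, List.mem_singleton, not_or] at h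
    exact bef_tot ht' (Ne.symm h.2) h.1
  · intro h
    simp only [List.mem_append, List.mem_singleton, not_or]
    refine ⟨bef_anti hd' h, ?_⟩
    rintro rfl
    exact not_mem_bef _ _ h

theorem bef_len {w : List ℕ} {d e : ℕ} (hd : d ∈ w) (h : e ∈ bef d w) :
    (bef e w).length < (bef d w).length := by
  obtain ⟨q, hq⟩ := bef_split hd
  have : bef e w = bef e (bef d w) := by
    conv_lhs => rw [hq]
    exact bef_app_mem _ h
  obtain ⟨r, hr⟩ := bef_split h
  rw [this]
  conv_rhs => rw [hr]
  simp

theorem order_of_hdiv {u v : List ℕ} (hs : ∀ t, u.count t = 1 ↔ v.count t = 1)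
    (h : ∀ x ∈ u, hdiv u x 1 = hdiv v x 1) : ∀ n d, u.count d = 1 → (bef d u).length = n →
    ∀ t, u.count t = 1 → (t ∈ bef d u ↔ t ∈ bef d v) := by
  intro n
  induction n using Nat.strong_induction_on with
  | _ n ih =>
    intro d hd hn t ht
    have hdu : d ∈ u := List.count_pos_iff.1 (by omega)
    have hh := h d hdu
    have Ku := fun s hs' => K_one (w := u) (d := d) (t := s) hd hs'
    have Kv := fun s hs' => K_one (w := v) (d := d) (t := s) ((hs d).1 hd) hs'
    rcases hdiv_spec u d 0 with ⟨a1, a2⟩ | ⟨e, a1, a2, a3⟩ <;>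
      rcases hdiv_spec v d 0 with ⟨b1, b2⟩ | ⟨e', b1, b2, b3⟩
    · have h1 := a2 t ht
      have h2 := b2 t ((hs t).1 ht)
      rw [Ku t ht] at h1
      rw [Kv t ((hs t).1 ht)] at h2
      tauto
    · simp only [zero_add] at a1 b1
      rw [a1, b1] at hh; simp at hh
    · simp only [zero_add] at a1 b1
      rw [a1, b1] at hh; simp at hh
    · simp only [zero_add] at a1 b1
      rw [a1, b1] at hh
      obtain rfl : e = e' := by simpa using hh
      have h1 := a3 t ht
      have h2 := b3 t ((hs t).1 ht)
      rw [Ku t ht] at h1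
      rw [Kv t ((hs t).1 ht)] at h2
      have he : e ∈ bef d u := by
        have := a3 e a2
        rw [Ku e a2] at this
        exact this.2 (Or.inl rfl)
      have := ih _ (by rw [← hn]; exact bef_len hdu he) e a2 rfl t ht
      rw [h1, h2, this]

theorem hdiv_iff {u v : List ℕ} (hs : ∀ t, u.count t = 1 ↔ v.count t = 1)
    (ho : ∀ d, u.count d = 1 → ∀ t, u.count t = 1 → (t ∈ bef d u ↔ t ∈ bef d v))
    (x i j : ℕ) (hi : 1 ≤ i) (hj : 1 ≤ j) :
    hdiv u x i = hdiv v x j ↔ ∀ t, u.count t = 1 →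
      ((bef t u ++ [t]).count x < i ↔ (bef t v ++ [t]).count x < j) := by
  obtain ⟨i, rfl⟩ := Nat.exists_eq_add_of_le' hi
  obtain ⟨j, rfl⟩ := Nat.exists_eq_add_of_le' hj
  rcases hdiv_spec u x i with ⟨a1, a2⟩ | ⟨e, a1, a2, a3⟩ <;>
    rcases hdiv_spec v x j with ⟨b1, b2⟩ | ⟨e', b1, b2, b3⟩ <;> rw [a1, b1]
  · refine ⟨fun _ t ht => ?_, fun _ => rfl⟩
    have h1 := a2 t ht
    have h2 := b2 t ((hs t).1 ht)
    tauto
  · refine ⟨fun h => by simp at h, fun h => ?_⟩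
    have h0 := (hs e').2 b2
    exact absurd ((h e' h0).2 ((b3 e' b2).2 (Or.inl rfl))) (a2 e' h0)
  · refine ⟨fun h => by simp at h, fun h => ?_⟩
    exact absurd ((h e a2).1 ((a3 e a2).2 (Or.inl rfl))) (b2 e ((hs e).1 a2))
  · constructor
    · intro h t ht
      obtain rfl : e = e' := by simpa using h
      rw [a3 t ht, b3 t ((hs t).1 ht), ho e a2 t ht]
    · intro h
      have h0 := (hs e').2 b2
      have c1 := (b3 e ((hs e).1 a2)).1 ((h e a2).1 ((a3 e a2).2 (Or.inl rfl)))
      have c2 := (a3 e' h0).1 ((h e' h0).2 ((b3 e' b2).2 (Or.inl rfl)))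
      rcases c1 with rfl | c1
      · rfl
      rcases c2 with rfl | c2
      · rfl
      rw [ho e a2 e' h0] at c2
      exact absurd c2 (bef_anti (List.count_pos_iff.1 (by omega)) c1)

theorem rev_count {w : List ℕ} {t : ℕ} (ht : w.count t = 1) (x : ℕ) :
    w.count x = (bef t w ++ [t]).count x + (bef t w.reverse).count x := by
  obtain ⟨q, e, hq⟩ := simple_split ht
  rw [bef_reverse e hq, List.count_reverse]
  conv_lhs => rw [e]
  rw [← List.count_append]
  simp

theorem inv_iff (u v : List ℕ) :
    (Inv 2 u v ∧ Inv 1 u.reverse v.reverse) ↔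
    ((simpleSet u = simpleSet v ∧ mulSet u = mulSet v) ∧
     (∀ x ∈ conL u, hdiv u x 1 = hdiv v x 1) ∧
     (∀ x ∈ conL u, hdiv u x 2 = hdiv v x 2) ∧
     (∀ x ∈ conL u, tdiv u x = tdiv v x)) := by
  have cnt : ∀ (w : List ℕ) (t x : ℕ),
      (bef t w ++ [t]).count x = (bef t w).count x + if t = x then 1 else 0 := by
    intro w t x
    rw [List.count_append, List.count_singleton]
    simp
  have bz : ∀ (w : List ℕ) (t : ℕ), (bef t w).count t = 0 :=
    fun w t => List.count_eq_zero_of_not_mem (not_mem_bef _ _)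
  constructor
  · rintro ⟨h2, h1⟩
    have hs : ∀ t, u.count t = 1 ↔ v.count t = 1 := fun t => by have := h2.1 t; omega
    have ho : ∀ d, u.count d = 1 → ∀ t, u.count t = 1 → (t ∈ bef d u ↔ t ∈ bef d v) := by
      intro d hd t _
      have := h2.2 d hd t
      rw [← List.count_pos_iff, ← List.count_pos_iff]
      omega
    refine ⟨⟨?_, ?_⟩, fun x _ => ?_, fun x _ => ?_, fun x hx => ?_⟩
    · ext t; exact hs t
    · ext t
      have := h2.1 t
      simp only [mulSet, Set.mem_ofPred_eq]
      omega
    · rw [hdiv_iff hs ho x 1 1 le_rfl le_rfl]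
      intro t ht
      rw [cnt, cnt]
      have := h2.2 t ht x
      omega
    · rw [hdiv_iff hs ho x 2 2 (by omega) (by omega)]
      intro t ht
      rw [cnt, cnt]
      have := h2.2 t ht x
      split_ifs with h
      · subst h; rw [bz, bz]
      · omega
    · have hxu : 0 < u.count x := List.count_pos_iff.2 hx
      have hxv : 0 < v.count x := by have := h2.1 x; omega
      unfold tdiv
      rw [hdiv_iff hs ho x _ _ hxu hxv]
      intro t ht
      have a := rev_count ht x
      have b := rev_count ((hs t).1 ht) x
      have := h1.2 t (by simpa using ht) x
      omega
  · rintro ⟨⟨hsim, hmul⟩, d1, d2, d3⟩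
    have hs : ∀ t, u.count t = 1 ↔ v.count t = 1 := fun t => Set.ext_iff.1 hsim t
    have hm : ∀ t, 2 ≤ u.count t ↔ 2 ≤ v.count t := fun t => Set.ext_iff.1 hmul t
    have hc : ∀ t, min 2 (u.count t) = min 2 (v.count t) := fun t => by
      have := hs t
      have := hm t
      omega
    have ho : ∀ d, u.count d = 1 → ∀ t, u.count t = 1 → (t ∈ bef d u ↔ t ∈ bef d v) :=
      fun d hd t ht => order_of_hdiv hs d1 _ d hd rfl t ht
    have bl : ∀ (w : List ℕ) (t x : ℕ), (bef t w).count x ≤ w.count x :=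
      fun w t x => (List.takeWhile_sublist _).count_le x
    refine ⟨⟨hc, fun t ht x => ?_⟩, fun x => by simpa using hc x, fun t ht x => ?_⟩
    · by_cases hx : x ∈ u
      · by_cases hxt : t = x
        · subst hxt; rw [bz, bz]
        have k1 := (hdiv_iff hs ho x 1 1 le_rfl le_rfl).1 (d1 x hx) t ht
        have k2 := (hdiv_iff hs ho x 2 2 (by omega) (by omega)).1 (d2 x hx) t ht
        rw [cnt, cnt] at k1 k2
        simp only [hxt, if_false, add_zero] at k1 k2
        omega
      · have := List.count_eq_zero_of_not_mem hx
        have := hc x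
        have := bl u t x
        have := bl v t x
        omega
    · rw [List.count_reverse] at ht
      have a := rev_count ht x
      have b := rev_count ((hs t).1 ht) x
      by_cases hx : x ∈ u
      · have hxu : 0 < u.count x := List.count_pos_iff.2 hx
        have hxv : 0 < v.count x := by have := hc x; omega
        have k := (hdiv_iff hs ho x _ _ hxu hxv).1 (d3 x hx) t ht
        omega
      · have := List.count_eq_zero_of_not_mem hx
        have := hc x
        omega

end WP

/-- Word problem for `F₀ ∨ E`: a non-trivial identity `u ≈ v` holds in every monoid
of `F₀` and every monoid of `E` iff `u` and `v` have the same simple and multiple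
letters and agree on the dividers `h₁`, `h₂` and `t` at every letter. -/
theorem word_problem_F_join_E (u v : Word) (hne : u ≠ v) :
    ((∀ (M : Type uM) [Monoid M], SatAll M F0set → MSat M (u, v)) ∧
     (∀ (M : Type uM) [Monoid M], SatAll M Eset → MSat M (u, v))) ↔
    ((simpleSet (toList u) = simpleSet (toList v) ∧
        mulSet (toList u) = mulSet (toList v)) ∧
     (∀ x ∈ conL (toList u), hdiv (toList u) x 1 = hdiv (toList v) x 1) ∧
     (∀ x ∈ conL (toList u), hdiv (toList u) x 2 = hdiv (toList v) x 2) ∧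
     (∀ x ∈ conL (toList u), tdiv (toList u) x = tdiv (toList v) x)) := by
  rw [← WP.inv_iff]
  constructor
  · rintro ⟨hF, hE⟩
    have h := WP.nec_F u v hF
    exact ⟨h, WP.nec_E u v h.1 hE⟩
  · rintro ⟨h2, h1⟩
    exact ⟨fun M _ hM => WP.suff_F0' u v h2 M hM, fun M _ hM => WP.suff_E' u v h1 M hM⟩
end

section
/- Let u ≈ v be an identity such that simple(u) = simple(v), mul(u) = mul(v), and h₁(u,x) = h₁(v,x) for every letter x ∈ con(u). If the decomposition of u is t₀ u₀ t₁ u₁ ⋯ t_m u_m, then the decomposition of v has the form t₀ v₀ t₁ v₁ ⋯ t_m v_m for some words v₀, v₁, …, v_m; that is, u and v have the same dividers occurring in the same order. -/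
open FreeMonoid

theorem assemble_cons (b0 : List ℕ) (p : ℕ × List ℕ) (ps : List (ℕ × List ℕ)) :
    assemble b0 (p :: ps) = b0 ++ p.1 :: assemble p.2 ps := by
  simp [assemble]

theorem exists_blocks (P : ℕ → Bool) (w : List ℕ) :
    ∃ c0 qs, w = assemble c0 qs ∧ (∀ p ∈ qs, P p.1 = true) ∧
      (∀ a ∈ c0, P a = false) ∧ ∀ p ∈ qs, ∀ a ∈ p.2, P a = false := by
  induction w with
  | nil => exact ⟨[], [], by simp [assemble]⟩
  | cons x w ih =>
    obtain ⟨c0, qs, h1, h2, h3, h4⟩ := ih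
    cases hx : P x with
    | true =>
      refine ⟨[], (x, c0) :: qs, by simp [assemble_cons, h1], ?_, by simp, ?_⟩
      · intro p hp
        rcases List.mem_cons.1 hp with rfl | hp
        · exact hx
        · exact h2 p hp
      · intro p hp
        rcases List.mem_cons.1 hp with rfl | hp
        · exact h3
        · exact h4 p hp
    | false =>
      refine ⟨x :: c0, qs, by simp [assemble, h1], h2, ?_, h4⟩
      intro a ha
      rcases List.mem_cons.1 ha with rfl | ha
      · exact hx
      · exact h3 a ha

theorem filter_assemble (P : ℕ → Bool) (qs : List (ℕ × List ℕ)) : ∀ (c0 : List ℕ),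
    (∀ p ∈ qs, P p.1 = true) → (∀ a ∈ c0, P a = false) →
    (∀ p ∈ qs, ∀ a ∈ p.2, P a = false) →
    (assemble c0 qs).filter P = qs.map Prod.fst := by
  induction qs with
  | nil =>
    intro c0 _ h3 _
    simp [assemble]
    exact h3
  | cons q qs ih =>
    intro c0 h2 h3 h4
    rw [assemble_cons, List.filter_append, List.filter_cons_of_pos (h2 q (by simp)),
      ih q.2 (fun p hp => h2 p (by simp [hp])) (h4 q (by simp))
        (fun p hp => h4 p (by simp [hp])),
      List.filter_eq_nil_iff.2 (by simpa using h3)]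
    simp

theorem nthOccIdx_one (p q : List ℕ) (x : ℕ) (hp : x ∉ p) :
    nthOccIdx (p ++ x :: q) x 1 = p.length := by
  unfold nthOccIdx
  have e : List.range (p ++ x :: q).length
      = List.range p.length ++ (List.range (q.length + 1)).map (p.length + ·) := by
    rw [← List.range_add]; simp
  rw [e, List.filter_append, List.filter_eq_nil_iff.2, List.range_succ_eq_map]
  · simp
  · intro j hj
    have hj' : j < p.length := List.mem_range.1 hj
    rw [List.getD_append _ _ _ _ hj', List.getD_eq_getElem _ _ hj']
    intro h
    exact hp ((beq_iff_eq.1 h) ▸ List.getElem_mem hj')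

theorem eq_prefix_of_pred (l l' : List ℕ)
    (h : ∀ x p q p' q', l = p ++ x :: q → l' = p' ++ x :: q' → p.getLast? = p'.getLast?) :
    ∀ (p : List ℕ) (x : ℕ) (q p' q' : List ℕ),
      l = p ++ x :: q → l' = p' ++ x :: q' → p = p' := by
  intro p
  induction p using List.reverseRecOn with
  | nil =>
    intro x q p' q' h1 h2
    have := h x _ _ _ _ h1 h2
    simp only [List.getLast?_nil] at this
    exact (List.getLast?_eq_none_iff.1 this.symm).symm
  | append_singleton p y ih =>
    intro x q p' q' h1 h2
    have := h x _ _ _ _ h1 h2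
    rw [List.getLast?_concat] at this
    obtain ⟨r, rfl⟩ := List.getLast?_eq_some_iff.1 this.symm
    rw [ih y (x :: q) r (x :: q') (by simpa using h1) (by simpa using h2)]

theorem length_le_of_pred (l l' : List ℕ) (hm : ∀ x ∈ l, x ∈ l')
    (h : ∀ x p q p' q', l = p ++ x :: q → l' = p' ++ x :: q' → p.getLast? = p'.getLast?) :
    l <+: l' := by
  rcases List.eq_nil_or_concat l with hl | ⟨p, x, hl⟩
  · simp [hl]
  · obtain ⟨p', q', h2⟩ := List.append_of_mem (hm x (by simp [hl]))
    have := eq_prefix_of_pred l l' h p x [] p' q' (by simpa using hl) h2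
    subst this
    exact ⟨q', by simp [hl, h2]⟩

theorem eq_of_pred (l l' : List ℕ) (hm : ∀ x, x ∈ l ↔ x ∈ l')
    (h : ∀ x p q p' q', l = p ++ x :: q → l' = p' ++ x :: q' → p.getLast? = p'.getLast?) :
    l = l' :=
  List.IsPrefix.eq_of_length_le (length_le_of_pred l l' (fun x => (hm x).1) h)
    (length_le_of_pred l' l (fun x => (hm x).2)
      (fun x p q p' q' h1 h2 => (h x p' q' p q h2 h1).symm)).length_le

/-- The list of dividers. -/
def dividersOf (w : List ℕ) : List ℕ := w.filter fun b => w.count b == 1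

theorem dividersOf_nodup (w : List ℕ) : (dividersOf w).Nodup := by
  rw [List.nodup_iff_count_le_one]
  intro a
  by_cases ha : a ∈ dividersOf w
  · have : w.count a = 1 := by simpa using (List.mem_filter.1 ha).2
    rw [← this]
    exact List.filter_sublist.count_le a
  · simp [List.count_eq_zero_of_not_mem ha]

theorem hdiv_eq_pred (w : List ℕ) (x : ℕ) (p q : List ℕ) (h : dividersOf w = p ++ x :: q) :
    hdiv w x 1 = p.getLast? := by
  have hx : x ∈ dividersOf w := by simp [h]
  have hc : w.count x = 1 := by simpa using (List.mem_filter.1 hx).2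
  obtain ⟨s, r, hs, hw⟩ := List.eq_append_cons_of_mem (List.mem_filter.1 hx).1
  have hd : dividersOf w
      = s.filter (fun b => w.count b == 1) ++ x :: r.filter (fun b => w.count b == 1) := by
    unfold dividersOf
    conv_lhs => rw [show List.filter (fun b => w.count b == 1) w
      = List.filter (fun b => w.count b == 1) (s ++ x :: r) by rw [← hs]]
    rw [List.filter_append, List.filter_cons_of_pos (by simp [hc])]
  have hh : hdiv w x 1 = (s.filter (fun b => w.count b == 1)).getLast? := by
    have hi : nthOccIdx w x 1 = s.length := by rw [hs]; exact nthOccIdx_one s r x hw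
    have ht : w.take s.length = s := by rw [hs]; simp
    unfold hdiv
    rw [hi, ht]
  have hn := dividersOf_nodup w
  have hp : x ∉ p := by
    rw [h] at hn
    intro hxp
    exact (List.nodup_append.1 hn).2.2 x hxp x (by simp) rfl
  have hsp : x ∉ s.filter (fun b => w.count b == 1) := fun hm => hw (List.mem_filter.1 hm).1
  rw [hh]
  have e := hd.symm.trans h
  have := congrArg (List.takeWhile (fun y => y != x)) e
  rw [List.takeWhile_append_of_pos, List.takeWhile_append_of_pos] at this
  · simp at this
    rw [this]
  · intro a ha; simp; rintro rfl; exact hp ha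
  · intro a ha; simp; rintro rfl; exact hsp ha

theorem isDecomp_dividers (w b0 : List ℕ) (ps : List (ℕ × List ℕ)) (hd : IsDecomp w b0 ps) :
    ps.map Prod.fst = dividersOf w := by
  obtain ⟨h1, h2, h3, h4⟩ := hd
  have := filter_assemble (fun b => w.count b == 1) ps b0 (by simpa using h2)
    (fun a ha => by have := h3 a ha; simp; omega)
    (fun p hp a ha => by have := h4 p hp a ha; simp; omega)
  rw [← h1] at this
  exact this.symm

theorem exists_isDecomp (w : List ℕ) : ∃ c0 qs, IsDecomp w c0 qs := by
  obtain ⟨c0, qs, h1, h2, h3, h4⟩ := exists_blocks (fun b => w.count b == 1) w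
  have key : ∀ a ∈ w, (w.count a == 1) = false → 2 ≤ w.count a := by
    intro a ha h
    have h0 := List.count_pos_iff.2 ha
    have h1 : w.count a ≠ 1 := by simpa using h
    omega
  refine ⟨c0, qs, h1, by simpa using h2, fun a ha => key a ?_ (h3 a ha),
    fun p hp a ha => key a ?_ (h4 p hp a ha)⟩
  · rw [h1]; simp [assemble, ha]
  · rw [h1]
    simp only [assemble, List.mem_append, List.mem_flatten, List.mem_map]
    exact Or.inr ⟨p.1 :: p.2, ⟨p, hp, rfl⟩, by simp [ha]⟩

/-- If `u ≈ v` satisfies `simple(u) = simple(v)`, `mul(u) = mul(v)` and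
`h₁(u,x) = h₁(v,x)` for all `x ∈ con(u)`, then the decomposition of `v` has the
same dividers, in the same order, as the decomposition of `u`. -/
theorem decompositions_have_same_dividers (u v : Word)
    (hsimple : simpleSet (toList u) = simpleSet (toList v))
    (hmul : mulSet (toList u) = mulSet (toList v))
    (hh1 : ∀ x ∈ conL (toList u), hdiv (toList u) x 1 = hdiv (toList v) x 1)
    (b0 : List ℕ) (ps : List (ℕ × List ℕ)) (hu : IsDecomp (toList u) b0 ps) :
    ∃ c0 qs, IsDecomp (toList v) c0 qs ∧ qs.map Prod.fst = ps.map Prod.fst := by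
  obtain ⟨c0, qs, hv⟩ := exists_isDecomp (toList v)
  refine ⟨c0, qs, hv, ?_⟩
  rw [isDecomp_dividers _ _ _ hv, isDecomp_dividers _ _ _ hu]
  have mem : ∀ (w : List ℕ) x, x ∈ dividersOf w ↔ x ∈ simpleSet w := by
    intro w x
    simp only [dividersOf, List.mem_filter, simpleSet, Set.mem_setOf_eq, beq_iff_eq]
    exact ⟨fun h => h.2, fun h => ⟨List.count_pos_iff.1 (by omega), h⟩⟩
  symm
  apply eq_of_pred
  · intro x
    rw [mem, mem, hsimple]
  · intro x p q p' q' h1 h2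
    rw [← hdiv_eq_pred _ x p q h1, ← hdiv_eq_pred _ x p' q' h2]
    apply hh1
    have : x ∈ dividersOf (toList u) := by simp [h1]
    exact (List.mem_filter.1 this).1
end
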